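/- Let n ≥ 3, γ > 1/2, T > 0, r > 0. For j = 1,…,n−2 let f_j : [−T,T]^{n−2} × \bar{D}_r(0) → ℝ be smooth functions vanishing to order two at 0, and let F : [−T,T]^{n−2} × \bar{D}_r(0) → ℂ be a smooth function vanishing to order three at 0 which moreover vanishes to order two in w at 0. Let M ⊆ ℂ^n be the image of the map (t₁,…,t_{n−2},w) ↦ (t₁ + i f₁(t,w,\bar w), …, t_{n−2} + i f_{n−2}(t,w,\bar w), w, w\bar w + γ(w² + \bar w²) + F(t,w,\bar w)), where t = (t₁,…,t_{n−2}) ∈ [−T,T]^{n−2} and w ∈ \bar{D}_r(0). Then there exists ε > 0 such that the compact set K = M ∩ \bar{B}_ε(0) is polynomially convex and satisfies 𝒫(K) = 𝒞(K); in particular M is locally polynomially convex at 0. -/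

import Mathlib

open Complex Metric ComplexConjugate Filter

noncomputable section

/-- A compact set `K ⊆ ℂⁿ` is polynomially convex: every point outside `K` is separated
from `K` by a holomorphic polynomial. -/
def IsPolyConvex {n : ℕ} (K : Set (Fin n → ℂ)) : Prop :=
  ∀ w : Fin n → ℂ, w ∉ K → ∃ P : MvPolynomial (Fin n) ℂ,
    ∀ z ∈ K, ‖MvPolynomial.eval z P‖ < ‖MvPolynomial.eval w P‖

/-- `𝒫(K) = 𝒞(K)`: every continuous function on `K ⊆ ℂⁿ` is a uniform limit on `K` of
(restrictions of) holomorphic polynomials. -/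
def PolyDenseInC {n : ℕ} (K : Set (Fin n → ℂ)) : Prop :=
  ∀ g : K → ℂ, Continuous g → ∀ ε : ℝ, 0 < ε →
    ∃ P : MvPolynomial (Fin n) ℂ, ∀ z : K, ‖MvPolynomial.eval (z : Fin n → ℂ) P - g z‖ < ε

/-- Resolvent lemma. -/
lemma aux_resolvent_mem {X : Type*} [TopologicalSpace X] [CompactSpace X]
    (A : Subalgebra ℂ C(X, ℂ)) (hA : IsClosed (A : Set C(X, ℂ))) (q : C(X, ℂ)) (hq : q ∈ A)
    (σ₀ : ℝ) (h : ∀ σ : ℝ, σ₀ ≤ σ → ∀ x, q x + σ ≠ 0) :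
    ∃ b ∈ A, ∀ x, b x * (q x + σ₀) = 1 := by
  have : IsClosed (A : Set C(X, ℂ)) := hA
  have key : (-(σ₀ : ℂ)) ∉ spectrum ℂ (⟨q, hq⟩ : A) := by
    intro hmem
    have hb := Subalgebra.spectrum_isBounded_connectedComponentIn A (⟨q, hq⟩ : A) hmem
    set R : Set ℂ := Set.image (fun σ : ℝ => (-(σ : ℂ))) (Set.Ici σ₀) with hR
    have hpre : IsPreconnected R :=
      isPreconnected_Ici.image _ (by fun_prop)
    have hsub : R ⊆ (spectrum ℂ (((⟨q, hq⟩ : A)) : C(X, ℂ)))ᶜ := by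
      rintro _ ⟨σ, hσ, rfl⟩
      simp only [ContinuousMap.spectrum_eq_range, Set.mem_compl_iff, Set.mem_range, not_exists]
      intro x hx
      apply h σ hσ x
      rw [hx]; ring
    have hR2 := hpre.subset_connectedComponentIn (x := -(σ₀ : ℂ)) ⟨σ₀, Set.mem_Ici.2 le_rfl, rfl⟩ hsub
    obtain ⟨C, hC⟩ := (hb.subset hR2).exists_norm_le
    have h1 := hC (-((max σ₀ (C + 1) : ℝ) : ℂ)) ⟨max σ₀ (C + 1), Set.mem_Ici.2 (le_max_left _ _), rfl⟩
    rw [norm_neg, Complex.norm_real, Real.norm_eq_abs] at h1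
    have h2 := le_abs_self (max σ₀ (C + 1))
    have h3 := le_max_right σ₀ (C + 1)
    linarith
  rw [spectrum.notMem_iff] at key
  obtain ⟨b, hb⟩ := key.exists_left_inv
  refine ⟨-(b : C(X, ℂ)), A.neg_mem b.2, fun x => ?_⟩
  have h1 := congrArg (fun a : A => (a : C(X, ℂ)) x) hb
  simp [Algebra.algebraMap_eq_smul_one] at h1 ⊢
  linear_combination h1


lemma aux_norm_add_I (r : ℂ) (c y : ℝ) (hc : 0 ≤ c) (hc1 : c ≤ 1) (h : c * ‖r‖ ≤ r.re) :
    c / 2 * |y| ≤ ‖r + y * I‖ := by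
  have h1 : r.re ≤ ‖r + y * I‖ := by
    have := Complex.re_le_norm (r + y * I)
    simpa using this
  have h2 : |y| ≤ ‖r + y * I‖ + ‖r‖ := by
    have := norm_sub_le (r + y * I) r
    simpa using this
  have h3 := norm_nonneg (r + y * I)
  nlinarith

lemma aux_norm_sq_add (r : ℂ) (c y : ℝ) (hc : 0 ≤ c) (hc1 : c ≤ 1) (h : c * ‖r‖ ≤ r.re) :
    c ^ 2 / 4 * y ^ 2 ≤ ‖r ^ 2 + (y : ℂ) ^ 2‖ := by
  have h1 := aux_norm_add_I r c y hc hc1 h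
  have h2 := aux_norm_add_I r c (-y) hc hc1 h
  have e : r ^ 2 + (y : ℂ) ^ 2 = (r + y * I) * (r + (-y : ℝ) * I) := by
    push_cast
    linear_combination ((y : ℂ) ^ 2) * I_sq
  rw [e, norm_mul]
  rw [abs_neg] at h2
  calc c ^ 2 / 4 * y ^ 2 = (c / 2 * |y|) * (c / 2 * |y|) := by
        rw [← sq_abs y]; ring
    _ ≤ _ := by gcongr

lemma aux_coth (r : ℂ) (hr : 0 < r.re) (N : ℕ) (hN : 0 < N) :
    ∑' k : ℕ, (r ^ 2 / (N * (r ^ 2 + (((k + 1 : ℝ) / N : ℝ) : ℂ) ^ 2))) * (2 / (Real.pi : ℂ))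
      + 1 / (Real.pi * N) - r =
      2 * r / (Complex.exp (2 * Real.pi * N * r) - 1) := by
  have hN' : (N : ℂ) ≠ 0 := by exact_mod_cast hN.ne'
  have hr0 : r ≠ 0 := by rintro rfl; simp at hr
  have hpi : (Real.pi : ℂ) ≠ 0 := by exact_mod_cast Real.pi_ne_zero
  set z : ℂ := I * N * r with hz
  have hz0 : z ≠ 0 := by simp [hz, hN', hr0]
  have hzim : 0 < z.im := by
    have : z.im = N * r.re := by simp [hz]
    rw [this]; positivity
  have hzmem : z ∈ Complex.integerComplement := by
    rintro ⟨m, hm⟩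
    rw [← hm] at hzim
    simp at hzim
  have hcot := cot_series_rep' hzmem
  have hterm : ∀ k : ℕ, (r ^ 2 / (N * (r ^ 2 + (((k + 1 : ℝ) / N : ℝ) : ℂ) ^ 2))) * (2 / (Real.pi : ℂ))
      = (1 / (z - (k + 1)) + 1 / (z + (k + 1))) * (I * r / Real.pi) := by
    intro k
    have h1 : z - (k + 1) ≠ 0 := by
      intro h
      have := congrArg Complex.im h
      simp at this; linarith
    have h2 : z + (k + 1) ≠ 0 := by
      intro h
      have := congrArg Complex.im h
      simp at this; linarith
    have h3 : (N : ℂ) * (r ^ 2 + (((k + 1 : ℝ) / N : ℝ) : ℂ) ^ 2) = - (z - (k + 1)) * (z + (k + 1)) / N := by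
      push_cast
      field_simp
      rw [hz]
      linear_combination (N : ℂ) ^ 2 * r ^ 2 * I_sq
    rw [h3]
    field_simp
    rw [hz]
    linear_combination (-2 * (N : ℂ) * r) * I_sq
  rw [tsum_congr hterm, tsum_mul_right, ← hcot, Complex.cot_pi_eq_exp_ratio]
  have he : 2 * (Real.pi : ℂ) * I * z = -(2 * Real.pi * N * r) := by
    rw [hz]; linear_combination (2 * (Real.pi : ℂ) * N * r) * I_sq
  rw [he, Complex.exp_neg]
  set e := Complex.exp (2 * Real.pi * N * r) with hedef
  have he0 : e ≠ 0 := Complex.exp_ne_zero _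
  have he1 : e - 1 ≠ 0 := by
    intro h
    have h1 : ‖e‖ = 1 := by rw [sub_eq_zero.1 h]; simp
    rw [hedef, Complex.norm_exp] at h1
    have : (2 * (Real.pi : ℂ) * N * r).re = 2 * Real.pi * N * r.re := by
      simp
    rw [this] at h1
    have h2 : 0 < 2 * Real.pi * N * r.re := by
      have := Real.pi_pos
      positivity
    have := Real.exp_eq_one_iff _ |>.1 h1
    linarith
  have he2 : 1 - e⁻¹ ≠ 0 := by
    intro h
    apply he1
    field_simp at h
    simpa using h
  rw [hz]
  field_simp
  ring_nf
  try simp only [I_sq]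
  try ring_nf

lemma aux_coth_est (r : ℂ) (c : ℝ) (hc : 0 < c) (hr : 0 < ‖r‖) (h : c * ‖r‖ ≤ r.re) (N : ℕ) (hN : 0 < N) :
    ‖2 * r / (Complex.exp (2 * Real.pi * N * r) - 1)‖ ≤ 1 / (c * N) := by
  have hpi := Real.pi_gt_three
  have hre : (2 * (Real.pi : ℂ) * N * r).re = 2 * Real.pi * N * r.re := by simp
  have h1 : 2 * Real.pi * N * r.re ≤ ‖Complex.exp (2 * Real.pi * N * r) - 1‖ := by
    have h2 := norm_sub_norm_le (Complex.exp (2 * Real.pi * N * r)) 1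
    rw [Complex.norm_exp, hre, norm_one] at h2
    have := Real.add_one_le_exp (2 * Real.pi * N * r.re)
    linarith
  have hN1 : (0:ℝ) < N := by exact_mod_cast hN
  have h0 : 2 * N * (c * ‖r‖) ≤ 2 * Real.pi * N * r.re := by
    have : 0 < c * ‖r‖ := by positivity
    have h3 : 2 * N * (c * ‖r‖) ≤ 2 * N * r.re := by gcongr
    nlinarith [mul_pos hN1 (this.trans_le h)]
  have hpos : 0 < 2 * N * (c * ‖r‖) := by positivity
  rw [norm_div, norm_mul]
  simp only [Complex.norm_ofNat]
  calc 2 * ‖r‖ / ‖Complex.exp (2 * Real.pi * N * r) - 1‖ ≤ 2 * ‖r‖ / (2 * N * (c * ‖r‖)) := by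
        gcongr; linarith
    _ = 1 / (c * N) := by field_simp

/-- Square roots inside a closed subalgebra. -/
lemma aux_sqrt_mem {X : Type*} [TopologicalSpace X] [CompactSpace X]
    (A : Subalgebra ℂ C(X, ℂ)) (hA : IsClosed (A : Set C(X, ℂ))) (r : C(X, ℂ)) (hq : r ^ 2 ∈ A)
    (c : ℝ) (hc : 0 < c) (hc1 : c ≤ 1) (h : ∀ x, c * ‖r x‖ ≤ (r x).re) : r ∈ A := by
  -- approximants
  have approx : ∀ N : ℕ, 0 < N → ∃ a ∈ A, ‖a - r‖ ≤ (1 / c + 1) * (1 / N) := by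
    intro N hN
    have hN1 : (0:ℝ) < N := by exact_mod_cast hN
    have hNc : (N : ℂ) ≠ 0 := by exact_mod_cast hN.ne'
    have hpi := Real.pi_gt_three
    have hres : ∀ k : ℕ, ∃ b ∈ A, ∀ x, b x * ((r x) ^ 2 + (((k + 1 : ℝ) / N : ℝ) : ℂ) ^ 2) = 1 := by
      intro k
      obtain ⟨b, hb, hb'⟩ := aux_resolvent_mem A hA (r ^ 2) hq (((k + 1 : ℝ) / N) ^ 2) (by
        intro σ hσ x hx
        have hσ0 : 0 < σ := lt_of_lt_of_le (by positivity) hσ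
        have := aux_norm_sq_add (r x) c (Real.sqrt σ) hc.le hc1 (h x)
        rw [Real.sq_sqrt hσ0.le] at this
        have e : ((Real.sqrt σ : ℝ) : ℂ) ^ 2 = σ := by
          rw [← Complex.ofReal_pow, Real.sq_sqrt hσ0.le]
        rw [e] at this
        simp only [ContinuousMap.coe_pow, Pi.pow_apply] at hx
        rw [hx, norm_zero] at this
        have : 0 < c ^ 2 / 4 * σ := by positivity
        linarith)
      refine ⟨b, hb, fun x => ?_⟩
      have := hb' x
      simpa using this
    choose b hbA hb using hres
    let term : ℕ → C(X, ℂ) := fun k => ((2 / (Real.pi : ℂ)) * (1 / N)) • (r ^ 2 * b k)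
    have hterm : ∀ k x, term k x = (r x ^ 2 / (N * (r x ^ 2 + (((k + 1 : ℝ) / N : ℝ) : ℂ) ^ 2))) * (2 / (Real.pi : ℂ)) := by
      intro k x
      have h1 := hb k x
      have h2 : (r x) ^ 2 + (((k + 1 : ℝ) / N : ℝ) : ℂ) ^ 2 ≠ 0 := right_ne_zero_of_mul_eq_one h1
      have h3 : b k x = 1 / ((r x) ^ 2 + (((k + 1 : ℝ) / N : ℝ) : ℂ) ^ 2) := by
        rw [eq_div_iff h2, h1]
      simp only [term, ContinuousMap.coe_smul, ContinuousMap.coe_mul, ContinuousMap.coe_pow,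
        Pi.smul_apply, Pi.mul_apply, Pi.pow_apply, smul_eq_mul, h3]
      rw [div_mul_eq_div_div]
      ring
    have htermA : ∀ k, term k ∈ A := fun k => A.smul_mem (A.mul_mem hq (hbA k)) _
    have hbound : ∀ k, ‖term k‖ ≤ (‖r‖ ^ 2 * (4 * N / c ^ 2)) * (1 / ((k + 1 : ℕ) : ℝ) ^ 2) := by
      intro k
      rw [ContinuousMap.norm_le _ (by positivity)]
      intro x
      rw [hterm, norm_mul, norm_div, norm_div, norm_mul, norm_pow]
      have h1 := aux_norm_sq_add (r x) c ((k + 1 : ℝ) / N) hc.le hc1 (h x)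
      have h2 : ‖(2:ℂ)‖ / ‖(Real.pi : ℂ)‖ ≤ 1 := by
        rw [Complex.norm_real, Real.norm_eq_abs, abs_of_pos (by linarith), Complex.norm_ofNat]
        rw [div_le_one (by linarith)]; linarith
      have h3 := r.norm_coe_le_norm x
      have h4 : 0 < c ^ 2 / 4 * ((k + 1 : ℝ) / N) ^ 2 := by positivity
      rw [Complex.norm_natCast]
      calc _ ≤ ‖r‖ ^ 2 / (N * (c ^ 2 / 4 * ((k + 1 : ℝ) / N) ^ 2)) * 1 := by
            gcongr
        _ = _ := by
            push_cast
            field_simp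
    have hsum : Summable term := by
      refine Summable.of_norm_bounded (Summable.mul_left _ ?_) hbound
      exact (summable_nat_add_iff 1).2 (Real.summable_one_div_nat_pow.2 (by norm_num))
    refine ⟨(∑' k, term k) + (1 / (Real.pi * N) : ℂ) • (1 : C(X, ℂ)),
      A.add_mem (hA.mem_of_tendsto hsum.hasSum.tendsto_sum_nat
        (Eventually.of_forall fun n => A.sum_mem fun k _ => htermA k)) (A.smul_mem A.one_mem _), ?_⟩
    rw [ContinuousMap.norm_le _ (by positivity)]
    intro x
    have hval : (∑' k, term k) x = ∑' k, term k x := (ContinuousMap.tsum_apply hsum x).symm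
    simp only [ContinuousMap.sub_apply, ContinuousMap.add_apply, hval, ContinuousMap.smul_apply, ContinuousMap.one_apply,
      smul_eq_mul, mul_one]
    simp only [hterm]
    by_cases hx : r x = 0
    · simp only [hx]
      simp only [ne_eq, OfNat.ofNat_ne_zero, not_false_eq_true, zero_pow, zero_div, zero_mul, tsum_zero, zero_add, sub_zero]
      rw [norm_div, norm_mul, Complex.norm_real, Real.norm_eq_abs, abs_of_pos (by linarith), Complex.norm_natCast, norm_one]
      calc 1 / (Real.pi * N) ≤ 1 / (1 * N) := by gcongr; linarith
        _ = 1 * (1 / N) := by ring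
        _ ≤ _ := by
          gcongr
          have : 0 < 1 / c := by positivity
          linarith
    · have hn : 0 < ‖r x‖ := norm_pos_iff.2 hx
      have hre : 0 < (r x).re := lt_of_lt_of_le (by positivity) (h x)
      rw [aux_coth (r x) hre N hN]
      refine (aux_coth_est (r x) c hc hn (h x) N hN).trans ?_
      have : 1 / (c * (N:ℝ)) = 1 / c * (1 / N) := by field_simp
      rw [this]
      gcongr
      linarith
  have hcl : r ∈ closure (A : Set C(X, ℂ)) := by
    rw [Metric.mem_closure_iff]
    intro ε hε
    have hc' : 0 < 1 / c + 1 := by positivity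
    obtain ⟨N, hN⟩ := exists_nat_gt ((1 / c + 1) / ε)
    have hN0 : (0:ℝ) < N := lt_trans (by positivity) hN
    obtain ⟨a, ha, hle⟩ := approx N (by exact_mod_cast hN0)
    refine ⟨a, ha, ?_⟩
    rw [dist_comm, dist_eq_norm]
    refine hle.trans_lt ?_
    rw [div_lt_iff₀ hε] at hN
    rw [mul_one_div, div_lt_iff₀ hN0]
    linarith
  rwa [hA.closure_eq] at hcl

/-- From `w, v² ∈ A` with `Re (w v)` coercive, get `v ∈ A`. -/
lemma aux_v_mem {X : Type*} [TopologicalSpace X] [CompactSpace X]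
    (A : Subalgebra ℂ C(X, ℂ)) (hA : IsClosed (A : Set C(X, ℂ))) (w v : C(X, ℂ))
    (hw : w ∈ A) (hv : v ^ 2 ∈ A)
    (c C : ℝ) (hc : 0 < c) (hC : 0 < C) (h1 : ∀ x, ‖w x‖ ≤ C * ‖v x‖)
    (h2 : ∀ x, c * ‖v x‖ ^ 2 ≤ (w x * v x).re) : v ∈ A := by
  have hr : w * v ∈ A := by
    refine aux_sqrt_mem A hA (w * v) (by rw [mul_pow]; exact A.mul_mem (A.pow_mem hw 2) hv)
      (min 1 (c / C)) (by positivity) (min_le_left _ _) ?_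
    intro x
    simp only [ContinuousMap.mul_apply, norm_mul]
    calc min 1 (c / C) * (‖w x‖ * ‖v x‖) ≤ c / C * ((C * ‖v x‖) * ‖v x‖) := by
          gcongr
          · exact min_le_right _ _
          · exact h1 x
      _ = c * ‖v x‖ ^ 2 := by field_simp
      _ ≤ _ := h2 x
  have hcl : v ∈ closure (A : Set C(X, ℂ)) := by
    rw [Metric.mem_closure_iff]
    intro ε hε
    -- δ with √(δ/c) ≤ ε
    set δ : ℝ := c * (ε / 2) ^ 2 with hδ
    have hδ0 : 0 < δ := by positivity
    have hre : ∀ x, 0 ≤ (w x * v x).re := fun x => le_trans (by positivity) (h2 x)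
    have hlow : ∀ σ : ℝ, ∀ x, (w x * v x).re + σ ≤ ‖w x * v x + σ‖ := by
      intro σ x
      have := Complex.re_le_norm (w x * v x + σ)
      simpa using this
    obtain ⟨b, hb, hb'⟩ := aux_resolvent_mem A hA (w * v) hr δ (by
      intro σ hσ x hx
      have h3 := hlow σ x
      simp only [ContinuousMap.mul_apply] at hx
      rw [hx, norm_zero] at h3
      have := hre x
      linarith)
    refine ⟨v ^ 2 * w * b, A.mul_mem (A.mul_mem hv hw) hb, ?_⟩
    rw [dist_eq_norm]
    refine lt_of_le_of_lt ?_ (half_lt_self hε)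
    rw [ContinuousMap.norm_le _ (by positivity)]
    intro x
    have h3 := hb' x
    simp only [ContinuousMap.mul_apply] at h3
    have e : (v - v ^ 2 * w * b) x = v x * (δ * b x) := by
      simp only [ContinuousMap.sub_apply, ContinuousMap.mul_apply, ContinuousMap.pow_apply]
      linear_combination (- v x) * h3
    rw [e, norm_mul, norm_mul, Complex.norm_real, Real.norm_eq_abs, abs_of_pos hδ0]
    have h4 := congrArg norm h3
    rw [norm_mul, norm_one] at h4
    have h5 := hlow δ x
    have h6 := h2 x
    set n := ‖w x * v x + δ‖
    have h7 : c * ‖v x‖ ^ 2 + δ ≤ n := by linarith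
    have hn : 0 < n := lt_of_lt_of_le (by positivity) h7
    have h8 : ‖b x‖ = 1 / n := by rw [eq_div_iff hn.ne', h4]
    rw [h8, mul_one_div, mul_div_assoc', div_le_iff₀ hn]
    have h9 : ‖v x‖ * δ ≤ ε / 2 * (c * ‖v x‖ ^ 2 + δ) := by
      rw [hδ]
      have : 0 ≤ c * (ε / 2) := by positivity
      nlinarith [mul_nonneg this (sq_nonneg (‖v x‖ - ε / 2)), mul_nonneg this (sq_nonneg (‖v x‖ + ε / 2)), mul_nonneg this (mul_nonneg (norm_nonneg (v x)) hε.le)]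
    refine h9.trans ?_
    gcongr
  rwa [hA.closure_eq] at hcl

lemma aux_exp_mem {X : Type*} [TopologicalSpace X] [CompactSpace X]
    (A : Subalgebra ℂ C(X, ℂ)) (hA : IsClosed (A : Set C(X, ℂ))) (a : C(X, ℂ)) (ha : a ∈ A)
    (k : C(X, ℂ)) (hk : ∀ x, k x = Complex.exp (a x)) : k ∈ A := by
  have hs := NormedSpace.expSeries_summable' (𝕂 := ℂ) a
  have hk' : k = ∑' n : ℕ, ((n.factorial : ℂ)⁻¹) • a ^ n := by
    ext x
    rw [← ContinuousMap.tsum_apply hs x, hk, Complex.exp_eq_exp_ℂ, NormedSpace.exp_eq_tsum ℂ]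
    simp
  rw [hk']
  exact hA.mem_of_tendsto hs.hasSum.tendsto_sum_nat
    (Eventually.of_forall fun n => A.sum_mem fun k _ => A.smul_mem (A.pow_mem ha _) _)

lemma aux_contraction {W : Type*} [NormedAddCommGroup W] [NormedSpace ℂ W]
    (A : Submodule ℂ W) (hA : IsClosed (A : Set W))
    (h : ∀ g : W, ∃ a ∈ A, ‖g - a‖ ≤ ‖g‖ / 2) (g : W) : g ∈ A := by
  have hne : (A : Set W).Nonempty := ⟨0, A.zero_mem⟩
  have hd : Metric.infDist g (A : Set W) ≤ 0 := by
    refine le_of_forall_pos_le_add fun η hη => ?_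
    obtain ⟨a, ha, hlt⟩ := (Metric.infDist_lt_iff hne).1
      (show Metric.infDist g (A : Set W) < Metric.infDist g (A : Set W) + η by linarith)
    obtain ⟨b, hb, hle⟩ := h (g - a)
    have h1 := Metric.infDist_le_dist_of_mem (x := g) (A.add_mem ha hb)
    rw [dist_eq_norm] at h1 hlt
    rw [sub_sub] at hle
    have h2 : Metric.infDist g (A : Set W) ≤ ‖g - (a + b)‖ := h1
    linarith
  have : g ∈ closure (A : Set W) := by
    rw [Metric.mem_closure_iff_infDist_zero hne]
    exact le_antisymm hd Metric.infDist_nonneg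
  rwa [hA.closure_eq] at this

lemma aux_integral_mem {W : Type*} [NormedAddCommGroup W] [NormedSpace ℂ W] [CompleteSpace W]
    (A : Submodule ℂ W) (hA : IsClosed (A : Set W)) {β : Type*} [MeasurableSpace β]
    (ν : MeasureTheory.Measure β) [MeasureTheory.IsFiniteMeasure ν] (Φ : β → W) (hΦ : MeasureTheory.Integrable Φ ν)
    (h : ∀ y, Φ y ∈ A) : ∫ y, Φ y ∂ν ∈ A := by
  by_cases hν : ν = 0
  · simp [hν]
  · have : NeZero ν := ⟨hν⟩
    have h1 := (A.restrictScalars ℝ).convex.average_mem (μ := ν) (f := Φ) hA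
      (Eventually.of_forall h) hΦ
    have h2 := MeasureTheory.measure_smul_average ν Φ
    rw [← h2]
    exact (A.restrictScalars ℝ).smul_mem _ h1

open MeasureTheory in
lemma aux_integrable_exp {V : Type*} [NormedAddCommGroup V] [NormedSpace ℝ V]
    [FiniteDimensional ℝ V] [MeasurableSpace V] [BorelSpace V] (μ : Measure V) [μ.IsAddHaarMeasure]
    (q : V → ℝ) (hqc : Continuous q) (hqs : ∀ (c : ℝ) x, q (c • x) = c ^ 2 * q x)
    (hqn : ∀ x, ‖x‖ ^ 2 ≤ q x) (a : ℝ) (ha : 0 < a) :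
    Integrable (fun x => Real.exp (-(a * q x))) μ := by
  have h1 : Integrable (fun x => Real.exp (-(q x))) μ := by
    set k : ℕ := Module.finrank ℝ V + 1 with hk
    have hk0 : (0:ℝ) < k := by positivity
    have hk1 : (1:ℝ) ≤ k := by rw [hk]; push_cast; linarith [(Nat.cast_nonneg (Module.finrank ℝ V) : (0:ℝ) ≤ _)]
    have hbase := integrable_one_add_norm (E := V) (μ := μ) (r := ((2 * k : ℕ) : ℝ))
      (by rw [hk]; push_cast; linarith [(Nat.cast_nonneg (Module.finrank ℝ V) : (0:ℝ) ≤ _)])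
    refine (hbase.const_mul ((2 * k : ℝ) ^ k)).mono' (by fun_prop) (Eventually.of_forall fun x => ?_)
    rw [Real.norm_eq_abs, Real.abs_exp, Real.rpow_neg (by positivity), Real.rpow_natCast]
    have h2 : (1 + ‖x‖) ^ (2 * k) ≤ (2 * k : ℝ) ^ k * Real.exp (‖x‖ ^ 2) := by
      have h3 : (1 + ‖x‖) ^ 2 ≤ 2 * k * Real.exp (‖x‖ ^ 2 / k) := by
        have h4 := Real.add_one_le_exp (‖x‖ ^ 2 / k)
        have h5 : 2 * k * (‖x‖ ^ 2 / k + 1) ≤ 2 * k * Real.exp (‖x‖ ^ 2 / k) := by gcongr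
        have h6 : 2 * k * (‖x‖ ^ 2 / k + 1) = 2 * ‖x‖ ^ 2 + 2 * k := by field_simp
        nlinarith [sq_nonneg (1 - ‖x‖)]
      calc (1 + ‖x‖) ^ (2 * k) = ((1 + ‖x‖) ^ 2) ^ k := by rw [pow_mul]
        _ ≤ (2 * k * Real.exp (‖x‖ ^ 2 / k)) ^ k := by gcongr
        _ = _ := by
          rw [mul_pow, ← Real.exp_nat_mul]
          congr 2
          field_simp
    rw [← div_eq_mul_inv, le_div_iff₀ (by positivity)]
    calc Real.exp (-q x) * (1 + ‖x‖) ^ (2 * k) ≤ Real.exp (-‖x‖ ^ 2) * ((2 * k : ℝ) ^ k * Real.exp (‖x‖ ^ 2)) := by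
          gcongr
          have := hqn x
          linarith
      _ = (2 * k : ℝ) ^ k * (Real.exp (-‖x‖ ^ 2) * Real.exp (‖x‖ ^ 2)) := by ring
      _ = _ := by rw [← Real.exp_add]; simp
  have h2 := h1.comp_smul (R := Real.sqrt a) (Real.sqrt_pos.2 ha).ne'
  simpa [hqs, Real.sq_sqrt ha.le] using h2

open MeasureTheory in
lemma aux_integral_scale {V : Type*} [NormedAddCommGroup V] [NormedSpace ℝ V]
    [FiniteDimensional ℝ V] [MeasurableSpace V] [BorelSpace V] (μ : Measure V) [μ.IsAddHaarMeasure]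
    (q : V → ℝ) (hqs : ∀ (c : ℝ) x, q (c • x) = c ^ 2 * q x) (a : ℝ) :
    ∫ x, Real.exp (-(a / 4 * q x)) ∂μ
      = 2 ^ (Module.finrank ℝ V) * ∫ x, Real.exp (-(a * q x)) ∂μ := by
  have := Measure.integral_comp_smul_of_nonneg μ (fun x => Real.exp (-(a * q x))) (1 / 2) (hR := by norm_num)
  simp only [hqs] at this
  rw [smul_eq_mul] at this
  convert this using 1
  · congr 1; ext x; congr 1; ring
  · congr 1; simp

lemma aux_t_exp (t : ℝ) : t * Real.exp (-t / 2) ≤ 4 * Real.exp (-t / 4) := by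
  have h1 := Real.add_one_le_exp (t / 4)
  have h2 : Real.exp (-t / 4) = Real.exp (t / 4) * Real.exp (-t / 2) := by
    rw [← Real.exp_add]; congr 1; ring
  rw [h2]
  have h3 := Real.exp_pos (-t / 2)
  nlinarith

lemma aux_exp_diff (P : ℂ) (Q κ N : ℝ) (hQ : 0 ≤ Q) (hN : 0 ≤ N) (hκ0 : 0 ≤ κ) (hκ : κ ≤ 1 / 2)
    (h : ‖P - Q‖ ≤ κ * Q) :
    ‖Complex.exp (-(N : ℂ) * P) - Real.exp (-(N * Q))‖ ≤ 4 * κ * Real.exp (-(N / 4 * Q)) := by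
  have e1 : Complex.exp (-(N : ℂ) * P) - Real.exp (-(N * Q))
      = (Real.exp (-(N * Q)) : ℂ) * (Complex.exp (-(N : ℂ) * (P - Q)) - 1) := by
    rw [mul_sub, Complex.ofReal_exp, ← Complex.exp_add]
    push_cast
    ring_nf
  have h1 : ‖-(N : ℂ) * (P - Q)‖ ≤ κ * (N * Q) := by
    rw [norm_mul, norm_neg, Complex.norm_real, Real.norm_eq_abs, abs_of_nonneg hN]
    nlinarith
  have h2 := Complex.norm_exp_sub_sum_le_norm_mul_exp (-(N : ℂ) * (P - Q)) 1
  simp only [Finset.range_one, Finset.sum_singleton, pow_zero, Nat.factorial_zero, Nat.cast_one, div_one, pow_one] at h2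
  have ht : 0 ≤ N * Q := by positivity
  have h3 : Real.exp ‖-(N : ℂ) * (P - Q)‖ ≤ Real.exp (N * Q / 2) := by
    apply Real.exp_le_exp.2
    nlinarith
  have h4 : ‖Complex.exp (-(N : ℂ) * (P - Q)) - 1‖ ≤ κ * (N * Q) * Real.exp (N * Q / 2) :=
    h2.trans (by gcongr)
  rw [e1, norm_mul, Complex.norm_real, Real.norm_eq_abs, Real.abs_exp]
  calc Real.exp (-(N * Q)) * ‖Complex.exp (-(N : ℂ) * (P - Q)) - 1‖
      ≤ Real.exp (-(N * Q)) * (κ * (N * Q) * Real.exp (N * Q / 2)) := by gcongr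
    _ = κ * ((N * Q) * (Real.exp (-(N * Q)) * Real.exp (N * Q / 2))) := by ring
    _ = κ * ((N * Q) * Real.exp (-(N * Q) / 2)) := by
        rw [← Real.exp_add]; congr 4; ring
    _ ≤ κ * (4 * Real.exp (-(N * Q) / 4)) := by
        gcongr κ * ?_
        exact aux_t_exp _
    _ = _ := by rw [show -(N * Q) / 4 = -(N / 4 * Q) by ring]; ring


lemma aux_pointwise (P Gy gx : ℂ) (Q κ N M e δ : ℝ) (hQ : 0 ≤ Q) (hN : 0 < N) (hκ0 : 0 ≤ κ)
    (hκ : κ ≤ 1 / 2) (hP : ‖P - Q‖ ≤ κ * Q) (hδ : 0 < δ) (he : 0 ≤ e) (hGy : ‖Gy‖ ≤ M)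
    (hgx : ‖gx‖ ≤ M) (hc : ‖Gy - gx‖ ≤ e ∨ δ ^ 2 ≤ Q) :
    ‖Gy * Complex.exp (-(N : ℂ) * P) - gx * Real.exp (-(N * Q))‖
      ≤ (4 * κ * M + 8 * M / (δ ^ 2 * N)) * Real.exp (-(N / 4 * Q))
        + e * Real.exp (-(N * Q)) := by
  have hM : 0 ≤ M := (norm_nonneg _).trans hGy
  have e1 : Gy * Complex.exp (-(N : ℂ) * P) - gx * Real.exp (-(N * Q))
      = Gy * (Complex.exp (-(N : ℂ) * P) - Real.exp (-(N * Q))) + (Gy - gx) * Real.exp (-(N * Q)) := by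
    ring
  have h1 := aux_exp_diff P Q κ N hQ hN.le hκ0 hκ hP
  have h2 : ‖Gy * (Complex.exp (-(N : ℂ) * P) - Real.exp (-(N * Q)))‖
      ≤ M * (4 * κ * Real.exp (-(N / 4 * Q))) := by
    rw [norm_mul]; gcongr
  have h3 : ‖Gy - gx‖ * Real.exp (-(N * Q)) ≤ 8 * M / (δ ^ 2 * N) * Real.exp (-(N / 4 * Q))
        + e * Real.exp (-(N * Q)) := by
    rcases hc with h | h
    · have : 0 ≤ 8 * M / (δ ^ 2 * N) * Real.exp (-(N / 4 * Q)) := by positivity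
      have : ‖Gy - gx‖ * Real.exp (-(N * Q)) ≤ e * Real.exp (-(N * Q)) := by gcongr
      linarith
    · have h4 : ‖Gy - gx‖ ≤ 2 * M / (δ ^ 2 * N) * (N * Q) := by
        have h5 : 2 * M ≤ 2 * M / (δ ^ 2 * N) * (N * Q) := by
          have : 2 * M / (δ ^ 2 * N) * (N * Q) = 2 * M * (Q / δ ^ 2) := by field_simp
          rw [this]
          have : 1 ≤ Q / δ ^ 2 := by rw [le_div_iff₀ (by positivity)]; linarith
          nlinarith
        have := norm_sub_le Gy gx
        linarith
      have h6 := aux_t_exp (N * Q)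
      have h7 : Real.exp (-(N * Q)) ≤ Real.exp (-(N * Q) / 2) := by
        apply Real.exp_le_exp.2
        have : 0 ≤ N * Q := by positivity
        linarith
      have h8 : 0 ≤ e * Real.exp (-(N * Q)) := by positivity
      calc ‖Gy - gx‖ * Real.exp (-(N * Q)) ≤ 2 * M / (δ ^ 2 * N) * (N * Q) * Real.exp (-(N * Q) / 2) := by
            gcongr
        _ = 2 * M / (δ ^ 2 * N) * ((N * Q) * Real.exp (-(N * Q) / 2)) := by ring
        _ ≤ 2 * M / (δ ^ 2 * N) * (4 * Real.exp (-(N * Q) / 4)) := by gcongr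
        _ = 8 * M / (δ ^ 2 * N) * Real.exp (-(N / 4 * Q)) := by
            rw [show -(N * Q) / 4 = -(N / 4 * Q) by ring]; ring
        _ ≤ _ := by linarith
  rw [e1]
  refine (norm_add_le _ _).trans ?_
  rw [norm_mul (Gy - gx), Complex.norm_real, Real.norm_eq_abs, Real.abs_exp]
  linarith

open MeasureTheory in
lemma aux_kernel {V : Type*} [NormedAddCommGroup V] [NormedSpace ℝ V]
    [FiniteDimensional ℝ V] [MeasurableSpace V] [BorelSpace V] (μ : Measure V) [μ.IsAddHaarMeasure]
    (q : V → ℝ) (hqc : Continuous q) (hqs : ∀ (c : ℝ) x, q (c • x) = c ^ 2 * q x)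
    (hqn : ∀ x, ‖x‖ ^ 2 ≤ q x) (ρ : ℝ) (hρ : 0 < ρ) (E : Set V) [CompactSpace E]
    (hE : E ⊆ closedBall 0 ρ)
    (A : Submodule ℂ C(E, ℂ)) (hA : IsClosed (A : Set C(E, ℂ)))
    (p : V → V → ℂ)
    (hp : Continuous (fun y : (closedBall (0 : V) (2 * ρ)) × E => p y.1 y.2))
    (κ : ℝ) (hκ0 : 0 ≤ κ) (hκ : 2 ^ (Module.finrank ℝ V) * (4 * κ) ≤ 1 / 8)
    (hpq : ∀ Y ∈ closedBall (0 : V) (2 * ρ), ∀ x ∈ E, ‖p Y x - q (x - Y)‖ ≤ κ * q (x - Y))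
    (hmem : ∀ (N : ℝ), ∀ Y ∈ closedBall (0 : V) (2 * ρ), ∀ k : C(E, ℂ),
      (∀ x : E, k x = Complex.exp (-(N : ℂ) * p Y x)) → k ∈ A) (g : C(E, ℂ)) : g ∈ A := by
  refine aux_contraction A hA (fun g => ?_) g
  by_cases hg0 : ‖g‖ = 0
  · exact ⟨0, A.zero_mem, by simp [hg0]⟩
  have hEc : IsClosed E := (isCompact_iff_compactSpace.2 inferInstance : IsCompact E).isClosed
  obtain ⟨G, hGn, hG⟩ := BoundedContinuousFunction.exists_norm_eq_domRestrict_eq hEc ℂ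
    (BoundedContinuousFunction.mkOfCompact g)
  have hGx : ∀ x : E, G x = g x := fun x => by
    have := DFunLike.congr_fun hG x
    simpa using this
  set M := ‖g‖ with hM
  have hMpos : 0 < M := lt_of_le_of_ne (norm_nonneg _) (Ne.symm hg0)
  have hGM : ∀ y, ‖G y‖ ≤ M := fun y => by
    have h1 := G.norm_coe_le_norm y
    rw [hGn, BoundedContinuousFunction.norm_mkOfCompact] at h1
    exact h1
  set D := Module.finrank ℝ V
  have hD1 : (1:ℝ) ≤ 2 ^ D := one_le_pow₀ (by norm_num)
  have hκ2 : κ ≤ 1 / 2 := by nlinarith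
  set B := closedBall (0 : V) (2 * ρ) with hB
  have hBc : IsCompact B := isCompact_closedBall _ _
  have : CompactSpace B := isCompact_iff_compactSpace.1 hBc
  obtain ⟨δ0, hδ0, huc⟩ := Metric.uniformContinuousOn_iff.1
    (hBc.uniformContinuousOn_of_continuous (f := G) G.continuous.continuousOn) (M / 8) (by positivity)
  set δ := min δ0 ρ with hδ
  have hδpos : 0 < δ := lt_min hδ0 hρ
  set N : ℝ := 64 * 2 ^ D / δ ^ 2 with hNdef
  have hN : 0 < N := by positivity
  set S := ∫ y, Real.exp (-(N * q y)) ∂μ with hS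
  have hintN := aux_integrable_exp μ q hqc hqs hqn N hN
  have hintN4 := aux_integrable_exp μ q hqc hqs hqn (N / 4) (by positivity)
  have hSpos : 0 < S := by
    apply integral_pos_of_integrable_nonneg_nonzero (x := 0) (by fun_prop) hintN
    · intro x; positivity
    · positivity
  set ν : Measure B := μ.comap Subtype.val with hν
  have hνfin : IsFiniteMeasure ν := by
    constructor
    rw [hν, Measure.comap_apply _ Subtype.val_injective (fun s hs => hBc.measurableSet.subtype_image hs) _ MeasurableSet.univ]
    simpa using hBc.measure_lt_top
  set ΦC : C(B × E, ℂ) := ⟨fun y => G y.1 * Complex.exp (-(N : ℂ) * p y.1 y.2), by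
    refine Continuous.mul (by fun_prop) (Continuous.cexp (continuous_const.mul hp))⟩ with hΦC
  set Φ : C(B, C(E, ℂ)) := ΦC.curry with hΦ
  have hΦi : Integrable (fun y => Φ y) ν :=
    Continuous.integrable_of_hasCompactSupport Φ.continuous (HasCompactSupport.of_compactSpace _)
  have hΦA : ∀ y, Φ y ∈ A := by
    intro y
    have : Φ y = G y • (⟨fun x => Complex.exp (-(N : ℂ) * p y x), by
        refine Continuous.cexp (continuous_const.mul (hp.comp (by fun_prop : Continuous fun x : E => (y, x))))⟩ : C(E, ℂ)) := by
      ext x; simp [hΦ, hΦC]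
    rw [this]
    exact A.smul_mem _ (hmem N y y.2 _ fun x => rfl)
  refine ⟨((S⁻¹ : ℝ) : ℂ) • ∫ y, Φ y ∂ν, A.smul_mem _ (aux_integral_mem A hA ν _ hΦi hΦA), ?_⟩
  rw [ContinuousMap.norm_le _ (by positivity)]
  intro x
  have ev : (∫ y, Φ y ∂ν) x = ∫ Y, B.indicator (fun Y => G Y * Complex.exp (-(N : ℂ) * p Y x)) Y ∂μ := by
    have h1 := ContinuousLinearMap.integral_comp_comm (ContinuousMap.evalCLM ℂ x) hΦi
    rw [ContinuousMap.evalCLM_apply] at h1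
    rw [← h1, integral_indicator hBc.measurableSet, ← integral_subtype_comap hBc.measurableSet]
    rfl
  have hI2 : Integrable (fun Y => g x * (Real.exp (-(N * q (x - Y))) : ℂ)) μ :=
    ((hintN.comp_sub_left (x : V)).ofReal).const_mul _
  have hI1 : Integrable (B.indicator (fun Y => G Y * Complex.exp (-(N : ℂ) * p Y x))) μ := by
    rw [integrable_indicator_iff hBc.measurableSet]
    apply ContinuousOn.integrableOn_compact hBc
    rw [continuousOn_iff_continuous_domRestrict]
    exact ΦC.continuous.comp (by fun_prop : Continuous fun y : B => (y, x))
  have hsh : ∫ Y, g x * (Real.exp (-(N * q (x - Y))) : ℂ) ∂μ = g x * S := by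
    rw [integral_const_mul, integral_complex_ofReal,
      integral_sub_left_eq_self (fun z => Real.exp (-(N * q z))) μ (x : V)]
  have key : ‖(∫ y, Φ y ∂ν) x - g x * S‖ ≤ S * (3 * M / 8) := by
    rw [ev, ← hsh, ← integral_sub hI1 hI2]
    have hbI : Integrable (fun Y => (4 * κ * M + 8 * M / (δ ^ 2 * N)) * Real.exp (-(N / 4 * q (x - Y)))
        + M / 8 * Real.exp (-(N * q (x - Y)))) μ :=
      ((hintN4.comp_sub_left (x : V)).const_mul _).add ((hintN.comp_sub_left (x : V)).const_mul _)
    refine (norm_integral_le_of_norm_le hbI (Eventually.of_forall fun Y => ?_)).trans ?_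
    · have hQ : 0 ≤ q (x - Y) := (sq_nonneg _).trans (hqn _)
      have hfar : δ ≤ ‖(x : V) - Y‖ → δ ^ 2 ≤ q (x - Y) := fun h =>
        (pow_le_pow_left₀ hδpos.le h 2).trans (hqn _)
      have hgxM : ‖g x‖ ≤ M := g.norm_coe_le_norm x
      by_cases hY : Y ∈ B
      · rw [Set.indicator_of_mem hY]
        refine aux_pointwise _ _ _ _ κ N M (M / 8) δ hQ hN hκ0 hκ2 (hpq Y hY x x.2) hδpos (by positivity)
          (hGM Y) hgxM ?_
        by_cases hd : δ ≤ ‖(x : V) - Y‖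
        · exact Or.inr (hfar hd)
        · left
          rw [← hGx, ← dist_eq_norm]
          refine (huc Y hY x ?_ ?_).le
          · have := hE x.2
            rw [hB]
            exact closedBall_subset_closedBall (by linarith) this
          · rw [dist_comm, dist_eq_norm]
            exact (not_le.1 hd).trans_le (min_le_left _ _)
      · rw [Set.indicator_of_notMem hY]
        have h1 := aux_pointwise (q (x - Y)) 0 (g x) (q (x - Y)) κ N M (M / 8) δ hQ hN hκ0 hκ2
          (by rw [sub_self, norm_zero]; positivity) hδpos (by positivity) (by simpa using hMpos.le) hgxM
          (Or.inr (hfar ?_))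
        · simpa using h1
        · have h2 := hE x.2
          rw [hB, mem_closedBall_zero_iff, not_le] at hY
          rw [mem_closedBall_zero_iff] at h2
          have h3 := norm_sub_norm_le Y (x : V)
          rw [norm_sub_rev] at h3
          have : δ ≤ ρ := min_le_right _ _
          linarith
    · rw [integral_add ((hintN4.comp_sub_left (x : V)).const_mul _) ((hintN.comp_sub_left (x : V)).const_mul _),
        integral_const_mul, integral_const_mul,
        integral_sub_left_eq_self (fun z => Real.exp (-(N * q z))) μ (x : V),
        integral_sub_left_eq_self (fun z => Real.exp (-(N / 4 * q z))) μ (x : V),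
        aux_integral_scale μ q hqs N, ← hS]
      have e1 : 8 * M / (δ ^ 2 * N) * 2 ^ D = M / 8 := by
        rw [hNdef]; field_simp; norm_num
      have e2 : (4 * κ * M + 8 * M / (δ ^ 2 * N)) * (2 ^ D * S) + M / 8 * S
        = (2 ^ D * (4 * κ)) * M * S + (8 * M / (δ ^ 2 * N) * 2 ^ D) * S + M / 8 * S := by ring
      rw [e2, e1]
      have : (2 ^ D * (4 * κ)) * M * S ≤ 1 / 8 * M * S := by gcongr
      linarith
  have e3 : (g - ((S⁻¹ : ℝ) : ℂ) • ∫ y, Φ y ∂ν) x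
      = -((S⁻¹ : ℝ) : ℂ) * ((∫ y, Φ y ∂ν) x - g x * S) := by
    have : (S : ℂ) ≠ 0 := by exact_mod_cast hSpos.ne'
    simp only [ContinuousMap.sub_apply, ContinuousMap.smul_apply, smul_eq_mul]
    push_cast
    field_simp
    ring
  rw [e3, norm_mul, norm_neg, Complex.norm_real, Real.norm_eq_abs, abs_of_pos (by positivity)]
  calc S⁻¹ * ‖(∫ y, Φ y ∂ν) x - g x * S‖ ≤ S⁻¹ * (S * (3 * M / 8)) := by gcongr
    _ = 3 * M / 8 := by field_simp
    _ ≤ M / 2 := by linarith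

lemma aux_core {m : ℕ} (ρ : ℝ) (hρ : 0 < ρ) (E : Set ((Fin m → ℝ) × ℂ)) [CompactSpace E]
    (hE : E ⊆ closedBall 0 ρ)
    (A : Subalgebra ℂ C(E, ℂ)) (hA : IsClosed (A : Set C(E, ℂ)))
    (f : Fin m → ((Fin m → ℝ) × ℂ) → ℝ) (G : ((Fin m → ℝ) × ℂ) → ℂ)
    (κ : ℝ) (hκ0 : 0 ≤ κ) (hκ1 : κ ≤ 1)
    (hκ : 2 ^ (Module.finrank ℝ ((Fin m → ℝ) × ℂ)) * (4 * ((3 * m + 1) * κ)) ≤ 1 / 8)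
    (hf : ∀ j, ∀ X ∈ closedBall (0 : (Fin m → ℝ) × ℂ) (2 * ρ), ∀ Y ∈ closedBall (0 : (Fin m → ℝ) × ℂ) (2 * ρ),
      |f j X - f j Y| ≤ κ * ‖X - Y‖)
    (hG : ∀ X ∈ closedBall (0 : (Fin m → ℝ) × ℂ) (2 * ρ), ∀ Y ∈ closedBall (0 : (Fin m → ℝ) × ℂ) (2 * ρ),
      ‖G X - G Y‖ ≤ κ * ‖X - Y‖)
    (hfA : ∀ j, ∀ k : C(E, ℂ), (∀ x : E, k x = (x.1.1 j : ℂ) + (f j x : ℂ) * I) → k ∈ A)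
    (hwA : ∀ k : C(E, ℂ), (∀ x : E, k x = x.1.2) → k ∈ A)
    (huA : ∀ k : C(E, ℂ), (∀ x : E, k x = conj x.1.2 + G x) → k ∈ A)
    (g : C(E, ℂ)) : g ∈ A := by
  set B := closedBall (0 : (Fin m → ℝ) × ℂ) (2 * ρ) with hB
  have hEB : E ⊆ B := hE.trans (closedBall_subset_closedBall (by linarith))
  have hfc : ∀ j, ContinuousOn (f j) B := fun j =>
    (LipschitzOnWith.of_dist_le_mul (K := ⟨κ, hκ0⟩) fun X hX Y hY => by
      rw [Real.dist_eq, dist_eq_norm]; exact hf j X hX Y hY).continuousOn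
  have hGc : ContinuousOn G B :=
    (LipschitzOnWith.of_dist_le_mul (K := ⟨κ, hκ0⟩) fun X hX Y hY => by
      rw [dist_eq_norm, dist_eq_norm]; exact hG X hX Y hY).continuousOn
  have hfcB : ∀ j, Continuous (fun x : B => f j x) := fun j =>
    continuousOn_iff_continuous_domRestrict.1 (hfc j)
  have hGcB : Continuous (fun x : B => G x) := continuousOn_iff_continuous_domRestrict.1 hGc
  have hfcE : ∀ j, Continuous (fun x : E => f j x) := fun j =>
    continuousOn_iff_continuous_domRestrict.1 ((hfc j).mono hEB)
  have hGcE : Continuous (fun x : E => G x) := continuousOn_iff_continuous_domRestrict.1 (hGc.mono hEB)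
  have hN : ∀ x : (Fin m → ℝ) × ℂ, ‖x‖ ^ 2 ≤ (∑ j, x.1 j ^ 2) + ‖x.2‖ ^ 2 := by
    intro x
    have hs : 0 ≤ ∑ j, x.1 j ^ 2 := Finset.sum_nonneg fun j _ => sq_nonneg _
    have h1 : ‖x.1‖ ^ 2 ≤ ∑ j, x.1 j ^ 2 := by
      rw [← Real.le_sqrt (norm_nonneg _) hs] 
      rw [pi_norm_le_iff_of_nonneg (Real.sqrt_nonneg _)]
      intro j
      rw [Real.le_sqrt (norm_nonneg _) hs, Real.norm_eq_abs, sq_abs]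
      exact Finset.single_le_sum (f := fun j => x.1 j ^ 2) (fun j _ => sq_nonneg _) (Finset.mem_univ j)
    rw [Prod.norm_def]
    rcases max_choice ‖x.1‖ ‖x.2‖ with h | h <;> rw [h]
    · have := sq_nonneg ‖x.2‖; linarith
    · linarith
  refine aux_kernel (MeasureTheory.Measure.addHaar : MeasureTheory.Measure ((Fin m → ℝ) × ℂ))
    (fun x => (∑ j, x.1 j ^ 2) + ‖x.2‖ ^ 2) (by fun_prop) ?_ hN ρ hρ E hE A.toSubmodule hA
    (fun Y X => (∑ j, (((X.1 j : ℂ) + (f j X : ℂ) * I) - ((Y.1 j : ℂ) + (f j Y : ℂ) * I)) ^ 2)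
      + (X.2 - Y.2) * ((conj X.2 + G X) - (conj Y.2 + G Y))) ?_ ((3 * m + 1) * κ) (by positivity) hκ ?_ ?_ g
  · intro c x
    simp only [Prod.smul_fst, Pi.smul_apply, smul_eq_mul, mul_pow, Prod.smul_snd, norm_smul, Real.norm_eq_abs, sq_abs, mul_add, Finset.mul_sum]
  · refine Continuous.add (continuous_finsetSum _ fun j _ => ?_) (Continuous.mul (by fun_prop) ?_)
    · have h1 := (hfcE j).comp (continuous_snd (X := B) (Y := E))
      have h2 := (hfcB j).comp (continuous_fst (X := B) (Y := E))
      refine Continuous.pow (Continuous.sub ?_ ?_) 2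
      · exact (continuous_ofReal.comp (by fun_prop)).add ((continuous_ofReal.comp h1).mul continuous_const)
      · exact (continuous_ofReal.comp (by fun_prop)).add ((continuous_ofReal.comp h2).mul continuous_const)
    · have h1 := hGcE.comp (continuous_snd (X := B) (Y := E))
      have h2 := hGcB.comp (continuous_fst (X := B) (Y := E))
      exact ((continuous_conj.comp (by fun_prop)).add h1).sub ((continuous_conj.comp (by fun_prop)).add h2)
  · intro Y hY X hX
    have hX := hEB hX
    set d := ‖X - Y‖ with hd
    have hd0 : 0 ≤ d := norm_nonneg _
    have e1 : ((∑ j, (((X.1 j : ℂ) + (f j X : ℂ) * I) - ((Y.1 j : ℂ) + (f j Y : ℂ) * I)) ^ 2)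
      + (X.2 - Y.2) * ((conj X.2 + G X) - (conj Y.2 + G Y)))
      - (((∑ j, (X - Y).1 j ^ 2) + ‖(X - Y).2‖ ^ 2 : ℝ) : ℂ)
      = (∑ j, ((2 * (X.1 j - Y.1 j) * (f j X - f j Y) : ℝ) * I - ((f j X - f j Y) ^ 2 : ℝ)))
        + (X.2 - Y.2) * (G X - G Y) := by
      have h1 : ((‖(X - Y).2‖ ^ 2 : ℝ) : ℂ) = (X.2 - Y.2) * (conj X.2 - conj Y.2) := by
        rw [← map_sub, Complex.mul_conj, Complex.normSq_eq_norm_sq]; simp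
      rw [Complex.ofReal_add, h1, Complex.ofReal_sum]
      have h2 : ∀ j, (((X.1 j : ℂ) + (f j X : ℂ) * I) - ((Y.1 j : ℂ) + (f j Y : ℂ) * I)) ^ 2
        = (((X - Y).1 j ^ 2 : ℝ) : ℂ) + ((2 * (X.1 j - Y.1 j) * (f j X - f j Y) : ℝ) * I - ((f j X - f j Y) ^ 2 : ℝ)) := by
        intro j
        simp only [Prod.fst_sub, Pi.sub_apply]
        push_cast
        ring_nf
        rw [Complex.I_sq]
        ring
      rw [Finset.sum_congr rfl fun j _ => h2 j, Finset.sum_add_distrib]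
      ring
    rw [e1]
    have h3 : ∀ j, ‖(((2 * (X.1 j - Y.1 j) * (f j X - f j Y) : ℝ) : ℂ) * I - ((f j X - f j Y) ^ 2 : ℝ))‖ ≤ 3 * κ * d ^ 2 := by
      intro j
      have h4 := hf j X hX Y hY
      have h5 : |X.1 j - Y.1 j| ≤ d := by
        have h6 := norm_le_pi_norm (X - Y).1 j
        have h7 := norm_fst_le (X - Y)
        simp only [Prod.fst_sub, Pi.sub_apply, Real.norm_eq_abs] at h6 h7
        exact h6.trans h7
      refine (norm_sub_le _ _).trans ?_
      rw [norm_mul, Complex.norm_I, mul_one, Complex.norm_real, Complex.norm_real, Real.norm_eq_abs, Real.norm_eq_abs, abs_mul, abs_mul, abs_pow, abs_two]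
      have h8 : |X.1 j - Y.1 j| * |f j X - f j Y| ≤ d * (κ * d) := by gcongr
      have h9 : |f j X - f j Y| ^ 2 ≤ (κ * d) ^ 2 := by gcongr
      have h10 : (κ * d) ^ 2 ≤ κ * d ^ 2 := by nlinarith [mul_nonneg hκ0 (sq_nonneg d)]
      nlinarith
    have h11 : ‖(X.2 - Y.2) * (G X - G Y)‖ ≤ κ * d ^ 2 := by
      have h12 := hG X hX Y hY
      have h13 : ‖X.2 - Y.2‖ ≤ d := norm_snd_le (X - Y)
      rw [norm_mul]
      calc _ ≤ d * (κ * d) := by gcongr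
        _ = _ := by ring
    have h14 : ‖∑ j, (((2 * (X.1 j - Y.1 j) * (f j X - f j Y) : ℝ) : ℂ) * I - ((f j X - f j Y) ^ 2 : ℝ))‖ ≤ m * (3 * κ * d ^ 2) := by
      refine (norm_sum_le_of_le _ fun j _ => h3 j).trans ?_
      simp
    have h15 := hN (X - Y)
    refine (norm_add_le _ _).trans ?_
    calc _ ≤ m * (3 * κ * d ^ 2) + κ * d ^ 2 := by linarith
      _ = (3 * m + 1) * κ * d ^ 2 := by ring
      _ ≤ _ := by gcongr
  · intro N Y hY k hk
    set Z : Fin m → C(E, ℂ) := fun j => ⟨fun x => (x.1.1 j : ℂ) + (f j x : ℂ) * I, by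
      exact (continuous_ofReal.comp (by fun_prop)).add ((continuous_ofReal.comp (hfcE j)).mul continuous_const)⟩ with hZ
    set W : C(E, ℂ) := ⟨fun x => x.1.2, by fun_prop⟩ with hW
    set U : C(E, ℂ) := ⟨fun x => conj x.1.2 + G x, (continuous_conj.comp (by fun_prop)).add hGcE⟩ with hU
    have hZA : ∀ j, Z j ∈ A := fun j => hfA j _ fun x => rfl
    have hWA : W ∈ A := hwA _ fun x => rfl
    have hUA : U ∈ A := huA _ fun x => rfl
    have hcA : ∀ c : ℂ, ContinuousMap.const E c ∈ A := fun c => A.algebraMap_mem c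
    refine aux_exp_mem A hA ((-(N : ℂ)) • ((∑ j, (Z j - ContinuousMap.const E ((Y.1 j : ℂ) + (f j Y : ℂ) * I)) ^ 2)
      + (W - ContinuousMap.const E Y.2) * (U - ContinuousMap.const E (conj Y.2 + G Y)))) ?_ k ?_
    · exact A.smul_mem (A.add_mem (A.sum_mem fun j _ => A.pow_mem (A.sub_mem (hZA j) (hcA _)) _)
        (A.mul_mem (A.sub_mem hWA (hcA _)) (A.sub_mem hUA (hcA _)))) _
    · intro x
      rw [hk x]
      congr 1
      simp [hZ, hW, hU]
      ring

lemma aux_lip {V W : Type*} [NormedAddCommGroup V] [NormedSpace ℝ V] [NormedAddCommGroup W]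
    [NormedSpace ℝ W] (f : V → W) (hf : ContDiffAt ℝ 1 f 0) (hd : fderiv ℝ f 0 = 0) (κ : ℝ) (hκ : 0 < κ) :
    ∃ δ > 0, ∀ X ∈ closedBall (0 : V) δ, ∀ Y ∈ closedBall (0 : V) δ, ‖f X - f Y‖ ≤ κ * ‖X - Y‖ := by
  have h1 := hf.hasStrictFDerivAt (by norm_num)
  rw [hd] at h1
  have h2 := h1.isLittleO.def hκ
  rw [nhds_prod_eq, Filter.eventually_prod_iff] at h2
  obtain ⟨p, hp, p', hp', h3⟩ := h2
  obtain ⟨δ, hδ, h4⟩ := Metric.nhds_basis_closedBall.eventually_iff.1 (hp.and hp')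
  refine ⟨δ, hδ, fun X hX Y hY => ?_⟩
  simpa using h3 (h4 hX).1 (h4 hY).2

lemma aux_F {U : Type*} [NormedAddCommGroup U] [NormedSpace ℝ U] (F : U × ℂ → ℂ)
    (hF : ContDiffAt ℝ 2 F 0) (hF2 : fderiv ℝ (fderiv ℝ F) 0 = 0)
    (hFw : Tendsto (fun p : U × ℂ => ‖F p‖ / ‖p.2‖ ^ 2) (nhdsWithin 0 {p : U × ℂ | p.2 ≠ 0}) (nhds 0))
    (η : ℝ) (hη : 0 < η) :
    ∃ δ > 0, (∀ X ∈ closedBall (0 : U × ℂ) δ, ‖F X‖ ≤ η * ‖X.2‖ ^ 2) ∧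
      ∀ X ∈ closedBall (0 : U × ℂ) δ, ∀ Y ∈ closedBall (0 : U × ℂ) δ, ‖Y.2‖ ≤ ‖X.2‖ →
        ‖F X - F Y‖ ≤ η * ‖X.2‖ * ‖X - Y‖ := by
  have h1 : ∀ᶠ X in nhds (0 : U × ℂ), X.2 ≠ 0 → ‖F X‖ ≤ η * ‖X.2‖ ^ 2 := by
    have := hFw.eventually (gt_mem_nhds hη)
    rw [eventually_nhdsWithin_iff] at this
    filter_upwards [this] with X hX hX2
    have h := hX hX2
    rw [div_lt_iff₀ (by positivity)] at h
    exact h.le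
  have h2 : ∀ᶠ X in nhds (0 : U × ℂ), ContDiffAt ℝ 2 F X := hF.eventually (by simp)
  obtain ⟨δ1, hδ1, h3⟩ := Metric.nhds_basis_ball.eventually_iff.1 (h1.and h2)
  have hG : ContDiffAt ℝ 1 (fderiv ℝ F) 0 := hF.fderiv_right (by norm_num)
  obtain ⟨δ2, hδ2, h4⟩ := aux_lip _ hG hF2 η hη
  -- bound everywhere on the ball
  have h5 : ∀ X ∈ ball (0 : U × ℂ) δ1, ‖F X‖ ≤ η * ‖X.2‖ ^ 2 := by
    intro X hX
    by_cases hX2 : X.2 = 0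
    · have hc : Continuous fun s : ℝ => (X.1, (s : ℂ)) := by
        exact continuous_const.prodMk continuous_ofReal
      have hX0 : (X.1, ((0 : ℝ) : ℂ)) = X := by
        ext <;> simp [hX2]
      have hcF : ContinuousAt (fun s : ℝ => F (X.1, (s : ℂ))) 0 := by
        refine ContinuousAt.comp (f := fun s : ℝ => (X.1, (s : ℂ))) (g := F) ?_ hc.continuousAt
        rw [hX0]
        exact (h3 hX).2.continuousAt
      have hev : ∀ᶠ s : ℝ in nhdsWithin 0 {0}ᶜ, ‖F (X.1, (s : ℂ))‖ ≤ η * ‖(s : ℂ)‖ ^ 2 := by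
        have : ∀ᶠ s : ℝ in nhds 0, (X.1, (s : ℂ)) ∈ ball (0 : U × ℂ) δ1 := by
          apply hc.continuousAt.eventually_mem
          rw [hX0]
          exact isOpen_ball.mem_nhds hX
        rw [eventually_nhdsWithin_iff]
        filter_upwards [this] with s hs hs0
        exact (h3 hs).1 (by simpa using hs0)
      have hl := le_of_tendsto_of_tendsto (hcF.tendsto.norm.mono_left nhdsWithin_le_nhds)
        (((by fun_prop : Continuous fun s : ℝ => η * ‖(s : ℂ)‖ ^ 2).tendsto 0).mono_left nhdsWithin_le_nhds) hev
      rw [hX0] at hl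
      simpa [hX2] using hl
    · exact (h3 hX).1 hX2
  have h6 : ∀ t : U, (t, (0 : ℂ)) ∈ ball (0 : U × ℂ) δ1 → fderiv ℝ F (t, 0) = 0 := by
    intro t ht
    have hF0 : F (t, 0) = 0 := by simpa using h5 _ ht
    apply HasFDerivAt.fderiv
    apply HasFDerivAt.of_isLittleO
    rw [Asymptotics.isLittleO_iff]
    intro c hc
    have : ∀ᶠ X in nhds (t, (0 : ℂ)), ‖X - (t, (0 : ℂ))‖ < c / η := by
      have h := Metric.ball_mem_nhds (t, (0 : ℂ)) (show 0 < c / η by positivity)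
      filter_upwards [h] with X hX
      rwa [mem_ball, dist_eq_norm] at hX
    filter_upwards [isOpen_ball.mem_nhds ht, this] with X hX hX2
    rw [hF0]
    have h7 : ‖X.2‖ ≤ ‖X - (t, (0 : ℂ))‖ := by
      have := norm_snd_le (X - (t, (0 : ℂ)))
      simpa using this
    have h8 := h5 X hX
    simp only [sub_zero, zero_apply]
    rw [lt_div_iff₀ hη] at hX2
    calc ‖F X‖ ≤ η * ‖X.2‖ ^ 2 := h8
      _ ≤ η * ‖X - (t, (0 : ℂ))‖ ^ 2 := by gcongr
      _ = (‖X - (t, (0 : ℂ))‖ * η) * ‖X - (t, (0 : ℂ))‖ := by ring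
      _ ≤ c * ‖X - (t, (0 : ℂ))‖ := by gcongr
  set δ := min (δ1 / 2) δ2 with hδ
  have hδp : 0 < δ := lt_min (by positivity) hδ2
  have hs1 : closedBall (0 : U × ℂ) δ ⊆ ball 0 δ1 := 
    closedBall_subset_ball ((min_le_left _ _).trans_lt (by linarith))
  have hs2 : closedBall (0 : U × ℂ) δ ⊆ closedBall 0 δ2 := closedBall_subset_closedBall (min_le_right _ _)
  refine ⟨δ, hδp, fun X hX => h5 X (hs1 hX), fun X hX Y hY hXY => ?_⟩
  have h9 : ∀ Z ∈ closedBall (0 : U × ℂ) δ, ‖fderiv ℝ F Z‖ ≤ η * ‖Z.2‖ := by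
    intro Z hZ
    have hZ0 : (Z.1, (0 : ℂ)) ∈ closedBall (0 : U × ℂ) δ := by
      rw [mem_closedBall_zero_iff] at hZ ⊢
      refine le_trans ?_ hZ
      rw [Prod.norm_def, Prod.norm_def]
      simp
    have := h4 Z (hs2 hZ) _ (hs2 hZ0)
    rw [h6 _ (hs1 hZ0), sub_zero] at this
    have e : ‖Z - (Z.1, (0 : ℂ))‖ = ‖Z.2‖ := by
      rw [Prod.norm_def]; simp
    rwa [e] at this
  have hconv : Convex ℝ (closedBall (0 : U × ℂ) δ ∩ (Prod.snd ⁻¹' closedBall (0 : ℂ) ‖X.2‖)) := by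
    apply (convex_closedBall _ _).inter
    exact (convex_closedBall (0 : ℂ) ‖X.2‖).linear_preimage (LinearMap.snd ℝ U ℂ)
  have := hconv.norm_image_sub_le_of_norm_fderiv_le (𝕜 := ℝ) (f := F) (C := η * ‖X.2‖)
    (fun Z hZ => (h3 (hs1 hZ.1)).2.differentiableAt (by norm_num))
    (fun Z hZ => (h9 Z hZ.1).trans (by
      have := hZ.2
      rw [Set.mem_preimage, mem_closedBall_zero_iff] at this
      gcongr)) (x := Y) (y := X) ⟨hY, by simpa using hXY⟩ ⟨hX, by simp⟩
  exact this

lemma aux_fderiv_of_iter {V W : Type*} [NormedAddCommGroup V] [NormedSpace ℝ V] [NormedAddCommGroup W]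
    [NormedSpace ℝ W] (f : V → W) (h : iteratedFDeriv ℝ 1 f 0 = 0) : fderiv ℝ f 0 = 0 := by
  ext v
  have := iteratedFDeriv_one_apply (𝕜 := ℝ) (f := f) (x := 0) (fun _ => v)
  rw [← this, h]
  simp

lemma aux_fderiv2_of_iter {V W : Type*} [NormedAddCommGroup V] [NormedSpace ℝ V] [NormedAddCommGroup W]
    [NormedSpace ℝ W] (f : V → W) (h : iteratedFDeriv ℝ 2 f 0 = 0) : fderiv ℝ (fderiv ℝ f) 0 = 0 := by
  ext v u
  have := iteratedFDeriv_two_apply (𝕜 := ℝ) f 0 ![v, u]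
  simp only [Matrix.cons_val_zero, Matrix.cons_val_one] at this
  rw [← this, h]
  simp

lemma aux_root1 (L H : ℂ) : ∃ G : ℂ, (L + G) ^ 2 = L ^ 2 + H ∧ ‖G‖ * ‖L‖ ≤ ‖H‖ := by
  obtain ⟨v, hv⟩ := IsAlgClosed.exists_pow_nat_eq (L ^ 2 + H) (n := 2) (by norm_num)
  have hp := parallelogram_law_with_norm ℝ v L
  have hH : ‖v - L‖ * ‖v + L‖ = ‖H‖ := by
    rw [← norm_mul]; congr 1; linear_combination hv
  by_cases h : ‖L‖ ≤ ‖v + L‖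
  · refine ⟨v - L, by rw [← hv]; ring, ?_⟩
    rw [← hH]; gcongr
  · refine ⟨-v - L, by rw [← hv]; ring, ?_⟩
    have h2 : ‖-v - L‖ = ‖v + L‖ := by rw [← norm_neg]; congr 1; ring
    rw [h2, ← hH, mul_comm]
    gcongr
    by_contra hc
    push Not at h hc
    have := norm_nonneg L
    have := norm_nonneg v
    nlinarith [norm_nonneg (v + L), norm_nonneg (v - L)]

lemma aux_root {U : Type*} [NormedAddCommGroup U] [NormedSpace ℝ U] (H : U × ℂ → ℂ)
    (lam η δ : ℝ) (hl0 : 0 < lam) (hl1 : lam < 1) (hη : 0 < η) (hη1 : η ≤ (1 - lam) ^ 2 / 2)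
    (h1 : ∀ X ∈ closedBall (0 : U × ℂ) δ, ‖H X‖ ≤ η * ‖X.2‖ ^ 2)
    (h2 : ∀ X ∈ closedBall (0 : U × ℂ) δ, ∀ Y ∈ closedBall (0 : U × ℂ) δ, ‖Y.2‖ ≤ ‖X.2‖ →
        ‖H X - H Y‖ ≤ η * ‖X.2‖ * ‖X - Y‖) :
    ∃ G : U × ℂ → ℂ,
      (∀ X ∈ closedBall (0 : U × ℂ) δ,
        (conj X.2 + lam * X.2 + G X) ^ 2 = (conj X.2 + lam * X.2) ^ 2 + H X ∧
        ‖X.2‖ ≤ 2 / (1 - lam) * ‖conj X.2 + lam * X.2 + G X‖ ∧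
        (1 - lam) / 18 * ‖conj X.2 + lam * X.2 + G X‖ ^ 2 ≤ (X.2 * (conj X.2 + lam * X.2 + G X)).re) ∧
      ∀ X ∈ closedBall (0 : U × ℂ) δ, ∀ Y ∈ closedBall (0 : U × ℂ) δ,
        ‖G X - G Y‖ ≤ 5 * η / (1 - lam) ^ 2 * ‖X - Y‖ := by
  choose G hG1 hG2 using fun X : U × ℂ => aux_root1 (conj X.2 + lam * X.2) (H X)
  set a := 1 - lam with ha
  have ha0 : 0 < a := by linarith
  have ha1 : a ≤ 1 := by linarith
  have hlw : ∀ w : ℂ, ‖(lam : ℂ) * w‖ = lam * ‖w‖ := fun w => by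
    rw [norm_mul, Complex.norm_real, Real.norm_eq_abs, abs_of_pos hl0]
  have hL : ∀ w : ℂ, a * ‖w‖ ≤ ‖conj w + lam * w‖ := fun w => by
    have := norm_sub_le (conj w + lam * w) (lam * w)
    rw [add_sub_cancel_right, hlw, RCLike.norm_conj] at this
    rw [ha]; linarith
  have hLu : ∀ w : ℂ, ‖conj w + lam * w‖ ≤ 2 * ‖w‖ := fun w => by
    have := norm_add_le (conj w) (lam * w)
    rw [hlw, RCLike.norm_conj] at this
    nlinarith [norm_nonneg w]
  have hG3 : ∀ X ∈ closedBall (0 : U × ℂ) δ, ‖G X‖ ≤ η / a * ‖X.2‖ := by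
    intro X hX
    have e1 := hG2 X
    have e2 := h1 X hX
    by_cases hw : X.2 = 0
    · have e3 := hG1 X
      have e4 : H X = 0 := by simpa [hw] using e2
      simp [hw, e4] at e3
      simp [hw, e3]
    · have hw0 : 0 < ‖X.2‖ := norm_pos_iff.2 hw
      have e3 : ‖G X‖ * (a * ‖X.2‖) ≤ η * ‖X.2‖ ^ 2 :=
        le_trans (by gcongr; exact hL _) (e1.trans e2)
      have e4 : ‖G X‖ * a ≤ η * ‖X.2‖ := by
        by_contra hc
        push Not at hc
        nlinarith
      rw [div_mul_eq_mul_div, le_div_iff₀ ha0]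
      exact e4
  have hηa : η / a ≤ a / 2 := by
    rw [div_le_iff₀ ha0]; nlinarith
  have hG4 : ∀ X ∈ closedBall (0 : U × ℂ) δ, ‖G X‖ ≤ a / 2 * ‖X.2‖ := fun X hX =>
    (hG3 X hX).trans (by gcongr)
  refine ⟨G, fun X hX => ⟨hG1 X, ?_, ?_⟩, ?_⟩
  · have e1 := hL X.2
    have e2 := hG4 X hX
    have e3 := norm_sub_le (conj X.2 + lam * X.2 + G X) (G X)
    rw [add_sub_cancel_right] at e3
    rw [div_mul_eq_mul_div, le_div_iff₀ ha0]
    linarith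
  · have e2 := hG4 X hX
    have e3 := norm_add_le (conj X.2 + lam * X.2) (G X)
    have e4 := hLu X.2
    have e5 : ‖conj X.2 + lam * X.2 + G X‖ ≤ 3 * ‖X.2‖ := by nlinarith [norm_nonneg X.2]
    have e6 : (X.2 * (conj X.2 + lam * X.2 + G X)).re
        = ‖X.2‖ ^ 2 + lam * (X.2 * X.2).re + (X.2 * G X).re := by
      rw [mul_add, mul_add, Complex.mul_conj, Complex.normSq_eq_norm_sq, Complex.add_re, Complex.add_re,
        Complex.ofReal_re, show X.2 * ((lam : ℂ) * X.2) = lam * (X.2 * X.2) by ring, Complex.re_ofReal_mul]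
    have e7 : -(‖X.2‖ ^ 2) ≤ (X.2 * X.2).re := by
      have := (abs_le.1 (Complex.abs_re_le_norm (X.2 * X.2))).1
      rw [norm_mul] at this
      linarith
    have e8 : -(a / 2 * ‖X.2‖ ^ 2) ≤ (X.2 * G X).re := by
      have := (abs_le.1 (Complex.abs_re_le_norm (X.2 * G X))).1
      rw [norm_mul] at this
      nlinarith [norm_nonneg X.2]
    have e9 : ‖conj X.2 + lam * X.2 + G X‖ ^ 2 ≤ (3 * ‖X.2‖) ^ 2 := by gcongr
    rw [e6]
    calc a / 18 * ‖conj X.2 + lam * X.2 + G X‖ ^ 2 ≤ a / 18 * (3 * ‖X.2‖) ^ 2 := by gcongr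
      _ = (1 - lam) * ‖X.2‖ ^ 2 - a / 2 * ‖X.2‖ ^ 2 := by rw [ha]; ring
      _ ≤ _ := by nlinarith
  · have main : ∀ X ∈ closedBall (0 : U × ℂ) δ, ∀ Y ∈ closedBall (0 : U × ℂ) δ, ‖Y.2‖ ≤ ‖X.2‖ →
        ‖G X - G Y‖ ≤ 5 * η / a ^ 2 * ‖X - Y‖ := by
      intro X hX Y hY hXY
      have gX := hG3 X hX
      have gY := hG3 Y hY
      by_cases hw : X.2 = 0
      · have hw' : Y.2 = 0 := by simpa [hw] using hXY
        have : G X = 0 := by simpa [hw] using gX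
        have h' : G Y = 0 := by simpa [hw'] using gY
        rw [this, h']
        simp only [sub_self, norm_zero]; positivity
      have hw0 : 0 < ‖X.2‖ := norm_pos_iff.2 hw
      have eH := h2 X hX Y hY hXY
      set d := ‖X - Y‖ with hd
      have hd0 : 0 ≤ d := norm_nonneg _
      have hdw : ‖X.2 - Y.2‖ ≤ d := norm_snd_le (X - Y)
      have eD : a * ‖X.2‖ ≤ ‖2 * (conj X.2 + lam * X.2) + G X + G Y‖ := by
        have e1 := hL X.2
        have e2 := hG4 X hX
        have e3 := hG4 Y hY
        have e4 := norm_sub_le (2 * (conj X.2 + lam * X.2) + G X + G Y) (G X + G Y)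
        rw [add_assoc, add_sub_cancel_right, norm_mul, Complex.norm_two] at e4
        have e5 := norm_add_le (G X) (G Y)
        rw [add_assoc]
        have e6 : a / 2 * ‖Y.2‖ ≤ a / 2 * ‖X.2‖ := by gcongr
        linarith
      have eL : ‖(conj X.2 + lam * X.2) - (conj Y.2 + lam * Y.2)‖ ≤ 2 * d := by
        have : (conj X.2 + lam * X.2) - (conj Y.2 + lam * Y.2) = conj (X.2 - Y.2) + lam * (X.2 - Y.2) := by
          rw [map_sub]; ring
        rw [this]
        exact (hLu _).trans (by linarith)
      have id : (G X - G Y) * (2 * (conj X.2 + lam * X.2) + G X + G Y)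
          = (H X - H Y) - 2 * G Y * ((conj X.2 + lam * X.2) - (conj Y.2 + lam * Y.2)) := by
        linear_combination hG1 X - hG1 Y
      have e7 : ‖G X - G Y‖ * (a * ‖X.2‖) ≤ η * ‖X.2‖ * d + 2 * (η / a * ‖X.2‖) * (2 * d) := by
        calc _ ≤ ‖G X - G Y‖ * ‖2 * (conj X.2 + lam * X.2) + G X + G Y‖ := by gcongr
          _ = ‖(H X - H Y) - 2 * G Y * ((conj X.2 + lam * X.2) - (conj Y.2 + lam * Y.2))‖ := by
            rw [← norm_mul, id]
          _ ≤ ‖H X - H Y‖ + ‖2 * G Y * ((conj X.2 + lam * X.2) - (conj Y.2 + lam * Y.2))‖ := norm_sub_le _ _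
          _ ≤ _ := by
            rw [norm_mul, norm_mul, Complex.norm_two]
            have : ‖G Y‖ ≤ η / a * ‖X.2‖ := gY.trans (by gcongr)
            gcongr
      have e8 : η ≤ η / a := by rw [le_div_iff₀ ha0]; nlinarith
      have e9 : ‖G X - G Y‖ * a * ‖X.2‖ ≤ (5 * (η / a) * d) * ‖X.2‖ := by
        have : η * ‖X.2‖ * d ≤ η / a * ‖X.2‖ * d := by gcongr
        linarith
      have e10 := le_of_mul_le_mul_right e9 hw0
      have e11 : 5 * η / a ^ 2 * d = (5 * (η / a) * d) / a := by field_simp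
      rw [e11, le_div_iff₀ ha0]
      exact e10
    intro X hX Y hY
    rcases le_total ‖Y.2‖ ‖X.2‖ with h | h
    · exact main X hX Y hY h
    · rw [norm_sub_rev, norm_sub_rev X Y]
      exact main Y hY X hX h

lemma aux_convex {n : ℕ} (K : Set (Fin n → ℂ)) (ε : ℝ) (hε : 0 < ε) (hK : K ⊆ closedBall 0 ε)
    (h : PolyDenseInC K) : IsPolyConvex K := by
  intro w hw
  set S : (Fin n → ℂ) → ℝ := fun z => ∑ k, ‖z k - w k‖ ^ 2 with hS
  have hSpos : ∀ z ∈ K, 0 < S z := by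
    intro z hz
    have hne : z ≠ w := fun h => hw (h ▸ hz)
    obtain ⟨k, hk⟩ := Function.ne_iff.1 hne
    refine Finset.sum_pos' (fun k _ => sq_nonneg _) ⟨k, Finset.mem_univ k, ?_⟩
    have : 0 < ‖z k - w k‖ := norm_pos_iff.2 (sub_ne_zero.2 hk)
    positivity
  set R : ℝ := ε + ‖w‖ with hR
  have hR0 : 0 < R := by positivity
  have hzR : ∀ z ∈ K, ∀ k, ‖z k - w k‖ ≤ R := by
    intro z hz k
    have h1 := hK hz
    rw [mem_closedBall_zero_iff] at h1
    have h2 := norm_le_pi_norm z k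
    have h3 := norm_le_pi_norm w k
    have h4 := norm_sub_le (z k) (w k)
    linarith
  have hcont : ∀ j, Continuous (fun z : K => conj (z.1 j - w j) / (S z.1 : ℂ)) := by
    intro j
    refine Continuous.div (continuous_conj.comp
      (((continuous_apply j).comp continuous_subtype_val).sub continuous_const)) (continuous_ofReal.comp (by fun_prop)) ?_
    intro z
    exact_mod_cast (hSpos z z.2).ne'
  choose Q hQ using fun j => h _ (hcont j) (1 / (n * R + 1)) (by positivity)
  refine ⟨1 - ∑ j, (MvPolynomial.X j - MvPolynomial.C (w j)) * Q j, fun z hz => ?_⟩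
  have e1 : MvPolynomial.eval w (1 - ∑ j, (MvPolynomial.X j - MvPolynomial.C (w j)) * Q j) = 1 := by
    simp
  have e2 : MvPolynomial.eval z (1 - ∑ j, (MvPolynomial.X j - MvPolynomial.C (w j)) * Q j)
      = - ∑ j, (z j - w j) * (MvPolynomial.eval z (Q j) - conj (z j - w j) / (S z : ℂ)) := by
    have hS0 : (S z : ℂ) ≠ 0 := by exact_mod_cast (hSpos z hz).ne'
    have h3 : ∑ j, (z j - w j) * (conj (z j - w j) / (S z : ℂ)) = 1 := by
      rw [Finset.sum_congr rfl fun j _ => (mul_div_assoc _ _ _).symm, ← Finset.sum_div, div_eq_one_iff_eq hS0, hS]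
      push_cast
      refine Finset.sum_congr rfl fun j _ => ?_
      rw [Complex.mul_conj, Complex.normSq_eq_norm_sq]
      push_cast
      rfl
    simp only [mul_sub, Finset.sum_sub_distrib, h3]
    simp [sub_mul]
  rw [e1, e2, norm_neg, norm_one]
  have h5 : ‖∑ j, (z j - w j) * (MvPolynomial.eval z (Q j) - conj (z j - w j) / (S z : ℂ))‖
      ≤ ∑ _j : Fin n, R * (1 / (n * R + 1)) := by
    refine norm_sum_le_of_le _ fun j _ => ?_
    rw [norm_mul]
    have := (hQ j ⟨z, hz⟩).le
    have := hzR z hz j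
    gcongr
  refine h5.trans_lt ?_
  simp only [Finset.sum_const, Finset.card_univ, Fintype.card_fin, nsmul_eq_mul]
  rw [← mul_assoc, mul_one_div, div_lt_one (by positivity)]
  linarith

/-- Let `n ≥ 3`, `γ > 1/2`, `T, r > 0`. Let `f_j` (`j = 1,…,n−2`) be smooth
real functions on `[−T,T]^{n−2} × D̄_r(0)` vanishing to order two at `0` (value and first
derivative vanish), and let `F` be a smooth complex function on the same domain vanishing to
order three at `0` (all derivatives of order `≤ 2` vanish) and vanishing to order two in `w`
at `0` (i.e. `|F(t,w)|/|w|² → 0` as `(t,w) → 0`, `w ≠ 0`). Let `M ⊆ ℂⁿ` be the image of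
`(t,w) ↦ (t₁ + i f₁(t,w), …, t_{n−2} + i f_{n−2}(t,w), w, w w̄ + γ(w² + w̄²) + F(t,w))`.
Then there is `ε > 0` such that `K = M ∩ B̄_ε(0)` is polynomially convex and satisfies
`𝒫(K) = 𝒞(K)`; in particular `M` is locally polynomially convex at `0`. -/
theorem hyperbolic_vanish_order_two_in_w_locally_polyConvex
    (n : ℕ) (hn : 3 ≤ n) (γ T r : ℝ) (hγ : 1/2 < γ) (hT : 0 < T) (hr : 0 < r)
    (f : Fin (n - 2) → ((Fin (n - 2) → ℝ) × ℂ) → ℝ)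
    (hfs : ∀ j, ContDiffOn ℝ (⊤ : ℕ∞) (f j)
      ((Set.univ.pi fun _ => Set.Icc (-T) T) ×ˢ closedBall (0 : ℂ) r))
    (hf2 : ∀ j, ∀ k : ℕ, k ≤ 1 → iteratedFDeriv ℝ k (f j) 0 = 0)
    (F : ((Fin (n - 2) → ℝ) × ℂ) → ℂ)
    (hFs : ContDiffOn ℝ (⊤ : ℕ∞) F
      ((Set.univ.pi fun _ => Set.Icc (-T) T) ×ˢ closedBall (0 : ℂ) r))
    (hF3 : ∀ k : ℕ, k ≤ 2 → iteratedFDeriv ℝ k F 0 = 0)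
    (hFw : Tendsto (fun p : (Fin (n - 2) → ℝ) × ℂ => ‖F p‖ / ‖p.2‖ ^ 2)
      (nhdsWithin 0 {p : (Fin (n - 2) → ℝ) × ℂ | p.2 ≠ 0}) (nhds 0))
    (M : Set (Fin n → ℂ))
    (hM : M = { z : Fin n → ℂ | ∃ t : Fin (n - 2) → ℝ, ∃ w : ℂ,
      (∀ j, |t j| ≤ T) ∧ ‖w‖ ≤ r ∧
      z = fun i : Fin n =>
        if h : (i : ℕ) < n - 2 then
          (t ⟨i.1, h⟩ : ℂ) + (f ⟨i.1, h⟩ (t, w) : ℂ) * Complex.I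
        else if (i : ℕ) = n - 2 then w
        else w * conj w + (γ : ℂ) * (w ^ 2 + (conj w) ^ 2) + F (t, w) }) :
    ∃ ε > (0:ℝ), IsPolyConvex (M ∩ closedBall 0 ε) ∧ PolyDenseInC (M ∩ closedBall 0 ε) := by
  -- constants
  set lam : ℝ := 1 / (2 * γ) with hlam
  have hγ0 : 0 < γ := by linarith
  have hl0 : 0 < lam := by positivity
  have hl1 : lam < 1 := by rw [hlam, div_lt_one (by positivity)]; linarith
  have hγl : (γ : ℂ) * (2 * lam) = 1 := by
    rw [hlam]; push_cast
    have : (γ : ℂ) ≠ 0 := by exact_mod_cast hγ0.ne'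
    field_simp
  set κ : ℝ := 1 / (32 * 2 ^ (Module.finrank ℝ ((Fin (n - 2) → ℝ) × ℂ)) * (3 * ((n - 2 : ℕ) : ℝ) + 1)) with hκdef
  have hκ0 : 0 < κ := by positivity
  have hκeq : 2 ^ (Module.finrank ℝ ((Fin (n - 2) → ℝ) × ℂ)) * (4 * ((3 * ((n - 2 : ℕ) : ℝ) + 1) * κ)) ≤ 1 / 8 := by
    rw [hκdef]
    apply le_of_eq
    field_simp
    norm_num
  have hκ1 : κ ≤ 1 := by
    rw [hκdef, div_le_one (by positivity)]
    have h1 : (1 : ℝ) ≤ 2 ^ (Module.finrank ℝ ((Fin (n - 2) → ℝ) × ℂ)) := one_le_pow₀ (by norm_num)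
    have h2 : (0 : ℝ) ≤ ((n - 2 : ℕ) : ℝ) := Nat.cast_nonneg _
    nlinarith
  set η : ℝ := κ * (1 - lam) ^ 2 / 5 with hηdef
  have hlp : 0 < 1 - lam := by linarith
  have hη0 : 0 < η := by positivity
  have hη1 : η ≤ (1 - lam) ^ 2 / 2 := by
    rw [hηdef]; nlinarith [sq_nonneg (1 - lam)]
  have hηκ : 5 * η / (1 - lam) ^ 2 = κ := by rw [hηdef]; field_simp
  -- smoothness near zero
  set dom : Set ((Fin (n - 2) → ℝ) × ℂ) :=
    (Set.univ.pi fun _ => Set.Icc (-T) T) ×ˢ closedBall (0 : ℂ) r with hdom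
  have hsub : ∀ s : ℝ, s ≤ T → s ≤ r → closedBall (0 : (Fin (n - 2) → ℝ) × ℂ) s ⊆ dom := by
    intro s hsT hsr X hX
    rw [mem_closedBall_zero_iff] at hX
    refine ⟨fun j _ => ?_, ?_⟩
    · have h1 := norm_le_pi_norm X.1 j
      have h2 := norm_fst_le X
      rw [Real.norm_eq_abs] at h1
      exact abs_le.1 (by linarith)
    · rw [mem_closedBall_zero_iff]
      have h2 := norm_snd_le X
      linarith
  have hnhds : dom ∈ nhds (0 : (Fin (n - 2) → ℝ) × ℂ) :=
    Filter.mem_of_superset (closedBall_mem_nhds _ (lt_min hT hr))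
      (hsub (min T r) (min_le_left _ _) (min_le_right _ _))
  have hle : ∀ k : ℕ, ((k : ℕ∞) : WithTop ℕ∞) ≤ ((⊤ : ℕ∞) : WithTop ℕ∞) := fun k => by
    exact_mod_cast le_top
  have hF2 : ContDiffAt ℝ 2 F 0 := (hFs.contDiffAt hnhds).of_le (hle 2)
  have hf1 : ∀ j, ContDiffAt ℝ 1 (f j) 0 := fun j => ((hfs j).contDiffAt hnhds).of_le (hle 1)
  choose δj hδj hδj2 using fun j => aux_lip (f j) (hf1 j) (aux_fderiv_of_iter _ (hf2 j 1 le_rfl)) κ hκ0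
  obtain ⟨δF, hδF, hFa, hFb⟩ := aux_F F hF2 (aux_fderiv2_of_iter _ (hF3 2 le_rfl)) hFw (η * γ) (by positivity)
  obtain ⟨δf, hδfj, hδf⟩ : ∃ δf : ℝ, (∀ j, δf ≤ δj j) ∧ 0 < δf := by
    have h1 : ∀ᶠ d in nhdsWithin (0 : ℝ) (Set.Ioi 0), ∀ j, d ≤ δj j := by
      rw [Filter.eventually_all]
      intro j
      filter_upwards [Ioc_mem_nhdsGT (hδj j)] with d hd
      exact hd.2
    obtain ⟨d, hd⟩ := (h1.and self_mem_nhdsWithin).exists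
    exact ⟨d, hd.1, hd.2⟩
  obtain ⟨δ, hδ0, hδ1, hδ2, hδ3, hδ4⟩ : ∃ δ : ℝ, 0 < δ ∧ δ ≤ δF ∧ δ ≤ δf ∧ δ ≤ T ∧ δ ≤ r :=
    ⟨min (min δF δf) (min T r), by positivity, by simp, by simp, by simp, by simp⟩
  have hBF : closedBall (0 : (Fin (n - 2) → ℝ) × ℂ) δ ⊆ closedBall 0 δF := closedBall_subset_closedBall hδ1
  have hBdom : closedBall (0 : (Fin (n - 2) → ℝ) × ℂ) δ ⊆ dom := hsub δ hδ3 hδ4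
  have hnγ : ∀ z : ℂ, ‖z / (γ : ℂ)‖ = ‖z‖ / γ := fun z => by
    rw [norm_div, Complex.norm_real, Real.norm_eq_abs, abs_of_pos hγ0]
  obtain ⟨G, hG1, hG2⟩ := aux_root (fun X => F X / (γ : ℂ)) lam η δ hl0 hl1 hη0 hη1
    (fun X hX => by
      rw [hnγ, div_le_iff₀ hγ0]
      exact (hFa X (hBF hX)).trans_eq (by ring))
    (fun X hX Y hY hXY => by
      rw [← sub_div, hnγ, div_le_iff₀ hγ0]
      exact (hFb X (hBF hX) Y (hBF hY) hXY).trans_eq (by ring))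
  rw [hηκ] at hG2
  -- the parametrisation
  set Φ : (Fin (n - 2) → ℝ) × ℂ → Fin n → ℂ := fun X i =>
    if h : (i : ℕ) < n - 2 then
          (X.1 ⟨i.1, h⟩ : ℂ) + (f ⟨i.1, h⟩ X : ℂ) * Complex.I
        else if (i : ℕ) = n - 2 then X.2
        else X.2 * conj X.2 + (γ : ℂ) * (X.2 ^ 2 + (conj X.2) ^ 2) + F X with hΦ
  set ij : Fin (n - 2) → Fin n := fun j => ⟨j, by have := j.2; omega⟩ with hij
  set iw : Fin n := ⟨n - 2, by omega⟩ with hiw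
  set il : Fin n := ⟨n - 1, by omega⟩ with hil
  have hΦj : ∀ X j, Φ X (ij j) = (X.1 j : ℂ) + (f j X : ℂ) * Complex.I := by
    intro X j
    simp [hΦ, hij]
  have hΦw : ∀ X, Φ X iw = X.2 := by
    intro X
    simp [hΦ, hiw]
  have hΦl : ∀ X, Φ X il = X.2 * conj X.2 + (γ : ℂ) * (X.2 ^ 2 + (conj X.2) ^ 2) + F X := by
    intro X
    have h1 : ¬ (n - 1 < n - 2) := by omega
    have h2 : ¬ (n - 1 = n - 2) := by omega
    simp only [hΦ, hil, h1, h2, dite_false, if_false]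
  have hΦc : ContinuousOn Φ (closedBall 0 δ) := by
    rw [continuousOn_pi]
    intro i
    by_cases h : (i : ℕ) < n - 2
    · simp only [hΦ, h, dite_true]
      refine ContinuousOn.add ?_ (ContinuousOn.mul (continuous_ofReal.comp_continuousOn ((hfs _).continuousOn.mono hBdom)) continuousOn_const)
      exact (continuous_ofReal.comp (by fun_prop)).continuousOn
    · by_cases h2 : (i : ℕ) = n - 2
      · simp only [hΦ, h, h2, dite_false, if_true]
        simpa using continuous_snd.continuousOn
      · simp only [hΦ, h, h2, dite_false, if_false]
        refine ContinuousOn.add ?_ (hFs.continuousOn.mono hBdom)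
        have hcj : Continuous fun X : (Fin (n - 2) → ℝ) × ℂ => conj X.2 := continuous_conj.comp continuous_snd
        exact Continuous.continuousOn (by fun_prop)
  have hGc : ContinuousOn G (closedBall 0 δ) :=
    (LipschitzOnWith.of_dist_le_mul (K := ⟨κ, hκ0.le⟩) fun X hX Y hY => by
      rw [dist_eq_norm, dist_eq_norm]; exact hG2 X hX Y hY).continuousOn
  set ρ := δ / 2 with hρ
  have hρ0 : 0 < ρ := by positivity
  have hρ2 : 2 * ρ = δ := by rw [hρ]; ring
  have hρδ : closedBall (0 : (Fin (n - 2) → ℝ) × ℂ) ρ ⊆ closedBall 0 δ := closedBall_subset_closedBall (by linarith)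
  set E : Set ((Fin (n - 2) → ℝ) × ℂ) := closedBall 0 ρ ∩ Φ ⁻¹' (closedBall 0 ρ) with hE
  have hEρ : E ⊆ closedBall 0 ρ := Set.inter_subset_left
  have hEδ : E ⊆ closedBall 0 δ := hEρ.trans hρδ
  have hEc : IsCompact E := by
    refine (isCompact_closedBall _ ρ).of_isClosed_subset ?_ hEρ
    exact (hΦc.mono hρδ).preimage_isClosed_of_isClosed isClosed_closedBall isClosed_closedBall
  have : CompactSpace E := isCompact_iff_compactSpace.1 hEc
  have hΦE : Continuous fun x : E => Φ x := continuousOn_iff_continuous_domRestrict.1 (hΦc.mono hEδ)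
  have hGE : Continuous fun x : E => G x := continuousOn_iff_continuous_domRestrict.1 (hGc.mono hEδ)
  -- the algebra
  set Z : Fin n → C(E, ℂ) := fun i => ⟨fun x => Φ x i, (continuous_apply i).comp hΦE⟩ with hZ
  set A0 : Subalgebra ℂ C(E, ℂ) := (MvPolynomial.aeval (R := ℂ) Z).range with hA0
  set A : Subalgebra ℂ C(E, ℂ) := A0.topologicalClosure with hA
  have hAc : IsClosed (A : Set C(E, ℂ)) := A0.isClosed_topologicalClosure
  have hev : ∀ (P : MvPolynomial (Fin n) ℂ) (x : E), (MvPolynomial.aeval Z P) x = MvPolynomial.eval (Φ x) P := by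
    intro P x
    induction P using MvPolynomial.induction_on with
    | C a => simp
    | add p q hp hq => simp [hp, hq]
    | mul_X p i hp =>
      rw [map_mul, ContinuousMap.mul_apply, hp, MvPolynomial.aeval_X, map_mul, MvPolynomial.eval_X]
      rfl
  have hZA : ∀ i, Z i ∈ A := fun i =>
    A0.le_topologicalClosure ⟨MvPolynomial.X i, by simp⟩
  have hwA : ∀ k : C(E, ℂ), (∀ x : E, k x = x.1.2) → k ∈ A := by
    intro k hk
    have : k = Z iw := by
      ext x; rw [hk]; exact (hΦw x).symm
    rw [this]; exact hZA iw
  have hcj : Continuous fun x : E => conj x.1.2 := continuous_conj.comp (by fun_prop)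
  set v : C(E, ℂ) := ⟨fun x => conj x.1.2 + lam * x.1.2 + G x,
    (hcj.add (continuous_const.mul (by fun_prop))).add hGE⟩ with hv
  set W : C(E, ℂ) := ⟨fun x => x.1.2, by fun_prop⟩ with hW
  have hWA : W ∈ A := hwA _ fun x => rfl
  have hvA : v ∈ A := by
    refine aux_v_mem A hAc W v hWA ?_ ((1 - lam) / 18) (2 / (1 - lam)) (by positivity) (by positivity)
      (fun x => (hG1 x (hEδ x.2)).2.1) (fun x => (hG1 x (hEδ x.2)).2.2)
    have : v ^ 2 = ((γ : ℂ)⁻¹) • Z il + ((lam : ℂ) ^ 2 - 1) • W ^ 2 := by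
      ext x
      have h1 := (hG1 x (hEδ x.2)).1
      have h2 := hΦl x
      have hγne : (γ : ℂ) ≠ 0 := by exact_mod_cast hγ0.ne'
      simp only [ContinuousMap.pow_apply, ContinuousMap.add_apply, ContinuousMap.smul_apply, smul_eq_mul, hv, hZ, hW, ContinuousMap.coe_mk]
      rw [h1, h2]
      field_simp
      linear_combination (x.1.2 * conj x.1.2) * hγl
    rw [this]
    exact A.add_mem (A.smul_mem (hZA il) _) (A.smul_mem (A.pow_mem hWA 2) _)
  have htop : ∀ g : C(E, ℂ), g ∈ A := by
    refine aux_core ρ hρ0 E hEρ A hAc f G κ hκ0.le hκ1 hκeq ?_ ?_ ?_ hwA ?_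
    · rw [hρ2]
      intro j X hX Y hY
      have hb : closedBall (0 : (Fin (n - 2) → ℝ) × ℂ) δ ⊆ closedBall 0 (δj j) :=
        closedBall_subset_closedBall (hδ2.trans (hδfj j))
      exact hδj2 j X (hb hX) Y (hb hY)
    · rw [hρ2]; exact hG2
    · intro j k hk
      have : k = Z (ij j) := by
        ext x; rw [hk]; exact (hΦj x j).symm
      rw [this]; exact hZA _
    · intro k hk
      have : k = v - (lam : ℂ) • W := by
        ext x; rw [hk]; simp [hv, hW]; ring
      rw [this]; exact A.sub_mem hvA (A.smul_mem hWA _)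
  have hMΦ : ∀ x ∈ E, Φ x ∈ M ∩ closedBall 0 ρ := by
    intro x hx
    refine ⟨?_, hx.2⟩
    rw [hM]
    have hd := hBdom (hEδ hx)
    refine ⟨x.1, x.2, fun j => abs_le.2 (hd.1 j (Set.mem_univ j)), ?_, rfl⟩
    simpa using hd.2
  have hdense : PolyDenseInC (M ∩ closedBall 0 ρ) := by
    intro g hg e he
    set gE : C(E, ℂ) := ⟨fun x => g ⟨Φ x, hMΦ x x.2⟩, hg.comp (hΦE.subtype_mk _)⟩ with hgE
    have h1 : gE ∈ closure (A0 : Set C(E, ℂ)) := htop gE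
    obtain ⟨b, ⟨P, hP⟩, hb⟩ := Metric.mem_closure_iff.1 h1 e he
    refine ⟨P, fun z => ?_⟩
    obtain ⟨z, hzM, hzB⟩ := z
    have hzM' := hzM
    rw [hM] at hzM'
    obtain ⟨t, w, ht, hw, hz⟩ := hzM'
    have hzΦ : z = Φ (t, w) := hz
    have hzn := hzB
    rw [mem_closedBall_zero_iff] at hzn
    have hX : (t, w) ∈ E := by
      refine ⟨?_, by rw [Set.mem_preimage, ← hzΦ]; exact hzB⟩
      rw [mem_closedBall_zero_iff, Prod.norm_def, max_le_iff]
      constructor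
      · rw [pi_norm_le_iff_of_nonneg hρ0.le]
        intro j
        have h2 := norm_le_pi_norm z (ij j)
        rw [hzΦ, hΦj] at h2
        have h3 := Complex.abs_re_le_norm ((t j : ℂ) + (f j (t, w) : ℂ) * Complex.I)
        simp only [Complex.add_re, Complex.ofReal_re, Complex.mul_re, Complex.I_re, mul_zero,
          Complex.ofReal_im, Complex.I_im, mul_one, sub_zero, add_zero] at h3
        rw [Real.norm_eq_abs]
        rw [← hzΦ] at h2
        linarith
      · have h2 := norm_le_pi_norm z iw
        rw [hzΦ, hΦw, ← hzΦ] at h2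
        exact h2.trans hzn
    have h4 := ContinuousMap.dist_apply_le_dist (f := gE) (g := b) ⟨(t, w), hX⟩
    have h5 : b ⟨(t, w), hX⟩ = MvPolynomial.eval z P := by
      rw [← hP, hzΦ]; exact hev P ⟨(t, w), hX⟩
    have h6 : gE ⟨(t, w), hX⟩ = g ⟨z, hzM, hzB⟩ := by
      simp only [hgE, ContinuousMap.coe_mk]
      congr 1
      exact Subtype.ext hzΦ.symm
    rw [h5, h6, dist_comm, dist_eq_norm] at h4
    exact h4.trans_lt hb
  exact ⟨ρ, hρ0, aux_convex _ ρ hρ0 Set.inter_subset_right hdense, hdense⟩
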